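/- Let 1 < s' < s and let x_N ∈ X^N be a configuration of N points on the two-sphere X with wce(x_N; s) ≤ 1. Then wce(x_N; s') ≤ c(s', s) · wce(x_N; s)^{s'/s}, where c(s', s) = √( Γ(s)/Γ(s') + (s^s e^{−s} + 1)/(Γ(s')(s'−1)) ) and Γ is the Gamma function. Moreover, for s' = 2, s = 2 + ε with 0 < ε ≤ 0.15 one has c(2, 2+ε) ≤ e^{1/2}. -/

import Mathlib

open MeasureTheory Real Metric
open scoped ENNReal RealInnerProductSpace Manifold

noncomputable section

/-- Euclidean 3-space. -/
abbrev E3 : Type := EuclideanSpace ℝ (Fin 3)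

/-- The unit two-sphere in `ℝ³`. -/
abbrev S2 : Type := Metric.sphere (0 : E3) 1

instance : Fact (Module.finrank ℝ E3 = 2 + 1) := ⟨finrank_euclideanSpace_fin⟩

/-- The Riemannian area measure `dV_g` on the unit two-sphere (total mass `4π`). -/
abbrev sphereArea : Measure S2 := (volume : Measure E3).toSphere

/-- The uniform probability measure `σ = dV_g / (4π)` on the unit two-sphere. -/
def sphereUniform : Measure S2 := (ENNReal.ofReal (4 * π))⁻¹ • sphereArea

instance : IsFiniteMeasure sphereUniform := by
  constructor
  rw [sphereUniform, Measure.smul_apply, smul_eq_mul]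
  exact ENNReal.mul_lt_top (by simp [Real.pi_pos]) (measure_lt_top _ _)

/-- The density (up to normalization) of the spherical ensemble:
`∏_{i ≠ j} |x_i − x_j| = ∏_{i < j} |x_i − x_j|²`. -/
def ensembleDensity (N : ℕ) (x : Fin N → S2) : ℝ≥0∞ :=
  ENNReal.ofReal (∏ p ∈ Finset.univ.offDiag, dist (x p.1) (x p.2))

/-- The spherical ensemble with `N` particles: the probability measure on `(S²)^N`
with density proportional to `∏_{i<j} |x_i − x_j|²` with respect to `σ^{⊗N}`. -/
def sphericalEnsemble (N : ℕ) : Measure (Fin N → S2) :=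
  (∫⁻ x, ensembleDensity N x ∂(Measure.pi fun _ : Fin N => sphereUniform))⁻¹ •
    (Measure.pi fun _ : Fin N => sphereUniform).withDensity (ensembleDensity N)

/-- The Legendre polynomial of degree `l` (Rodrigues' formula). -/
def legendreP (l : ℕ) : Polynomial ℝ :=
  Polynomial.C ((2 ^ l * l.factorial : ℝ)⁻¹) *
    (Polynomial.derivative^[l] ((Polynomial.X ^ 2 - 1) ^ l))

/-- The degree-`l` zonal harmonic kernel `Z_l(x,y) = ((2l+1)/(4π)) P_l(⟨x,y⟩)`, which is the
reproducing kernel of the eigenspace of the Laplace–Beltrami operator with eigenvalue `l(l+1)`,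
inside `L²(X, dV_g)`. -/
def zonal (l : ℕ) (x y : S2) : ℝ :=
  ((2 * l + 1 : ℝ) / (4 * π)) * (legendreP l).eval ⟪(x : E3), (y : E3)⟫

/-- `∫∫ f(x) Z_l(x,y) f(y) dV_g(x) dV_g(y)`, the squared `L²(dV_g)`-norm of the projection
of `f` onto the degree-`l` eigenspace of the Laplace–Beltrami operator. -/
def levelSq (l : ℕ) (f : S2 → ℝ) : ℝ :=
  ∫ x, ∫ y, f x * zonal l x y * f y ∂sphereArea ∂sphereArea

/-- The squared Sobolev norm `‖f‖²_{H^s(X)} = ∫_X f (Δ_g)^s f dV_g`, expressed spectrally: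
`Σ_{l≥1} (l(l+1))^s ‖proj_l f‖²_{L²(dV_g)}`, where `l(l+1)` are the positive eigenvalues of the
(positive) Laplace–Beltrami operator `Δ_g` on the unit two-sphere. -/
def sobNormSq (s : ℝ) (f : S2 → ℝ) : ℝ :=
  ∑' l : ℕ, (((l + 1) * (l + 2) : ℕ) : ℝ) ^ s * levelSq (l + 1) f

/-- Smooth real-valued functions on the two-sphere. -/
def SmoothOnSphere (f : S2 → ℝ) : Prop :=
  ContMDiff (𝓡 2) 𝓘(ℝ, ℝ) (⊤ : ℕ∞) f

/-- The worst-case error `wce(x_N; s)` of the numerical integration rule with node set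
`x_N = (x_1, …, x_N)` and smoothness parameter `s`. -/
def wce (N : ℕ) (s : ℝ) (x : Fin N → S2) : ℝ :=
  sSup { r | ∃ f : S2 → ℝ, SmoothOnSphere f ∧ sobNormSq s f ≤ 1 ∧
    r = |(∫ y, f y ∂sphereUniform) - (1 / N : ℝ) * ∑ i, f (x i)| }

end

noncomputable section

/-- The comparison constant `c(s', s) = √(Γ(s)/Γ(s') + (s^s e^{−s} + 1)/(Γ(s')(s'−1)))`. -/
def cComp (s' s : ℝ) : ℝ :=
  Real.sqrt (Real.Gamma s / Real.Gamma s' +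
    (s ^ s * Real.exp (-s) + 1) / (Real.Gamma s' * (s' - 1)))

section
open MeasureTheory Real Metric
open scoped ENNReal RealInnerProductSpace Manifold

noncomputable section
namespace WCE
open Finset

/-- Laplace eigenvalue. -/
def lam (n : ℕ) : ℝ := n * (n + 1)

/-- The Legendre multiplier of the kernel `(n+1) ((1+u)/2)^n`. -/
def bet (n l : ℕ) : ℝ := ∏ j ∈ range l, ((n : ℝ) - j) / (n + 2 + j)

lemma lam_nonneg (n : ℕ) : 0 ≤ lam n := by unfold lam; positivity

lemma lam_pos {n : ℕ} (h : 1 ≤ n) : 0 < lam n := by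
  have : (1:ℝ) ≤ n := by exact_mod_cast h
  unfold lam; positivity

lemma lam_inj {k l : ℕ} (h : lam k = lam l) : k = l := by
  unfold lam at h
  have h1 : ((k:ℝ) - l) * (k + l + 1) = 0 := by linarith
  rcases mul_eq_zero.1 h1 with h2 | h2
  · exact_mod_cast sub_eq_zero.1 h2
  · have : (0:ℝ) ≤ k := by positivity
    have : (0:ℝ) ≤ l := by positivity
    linarith

lemma bet_zero (n : ℕ) : bet n 0 = 1 := by simp [bet]

lemma bet_succ (n l : ℕ) : bet n (l+1) = bet n l * (((n : ℝ) - l) / (n + 2 + l)) := by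
  unfold bet; rw [prod_range_succ]

lemma bet_eq_zero {n l : ℕ} (h : n < l) : bet n l = 0 := by
  unfold bet
  exact prod_eq_zero (mem_range.2 h) (by simp)

lemma bet_nonneg (n l : ℕ) : 0 ≤ bet n l := by
  rcases lt_or_ge n l with h | h
  · rw [bet_eq_zero h]
  · unfold bet
    refine prod_nonneg fun j hj => ?_
    have : (j:ℝ) ≤ n := by exact_mod_cast ((mem_range.1 hj).le.trans h)
    have : (0:ℝ) ≤ n - j := by linarith
    positivity

lemma bet_le_one (n l : ℕ) : bet n l ≤ 1 := by
  induction l with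
  | zero => rw [bet_zero]
  | succ l ih =>
    rw [bet_succ]
    rcases lt_or_ge n l with h | h
    · rw [bet_eq_zero h]; simp
    · have h0 : (l:ℝ) ≤ n := by exact_mod_cast h
      have h1 : ((n : ℝ) - l) / (n + 2 + l) ≤ 1 := by
        rw [div_le_one (by positivity)]
        have : (0:ℝ) ≤ l := by positivity
        linarith
      have h2 : 0 ≤ ((n : ℝ) - l) / (n + 2 + l) := by
        have : (0:ℝ) ≤ n - l := by linarith
        positivity
      nlinarith [bet_nonneg n l]

lemma bet_rec (n l : ℕ) : lam (n+1) * bet n l = (lam (n+1) - lam l) * bet (n+1) l := by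
  induction l with
  | zero => simp [bet_zero, lam]
  | succ l ih =>
    rw [bet_succ, bet_succ]
    have e : lam (n+1) - lam l = ((n:ℝ) + 1 - l) * (n + 2 + l) := by
      unfold lam; push_cast; ring
    have e' : lam (n+1) - lam (l+1) = ((n:ℝ) - l) * (n + 3 + l) := by
      unfold lam; push_cast; ring
    rw [e] at ih
    rw [e', ← mul_assoc, ih]
    have h1 : (n:ℝ) + 2 + l ≠ 0 := by positivity
    have h2 : (n:ℝ) + 3 + l ≠ 0 := by positivity
    have h3 : ((n + 1 : ℕ):ℝ) + 2 + l ≠ 0 := by positivity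
    push_cast at *
    field_simp
    ring

lemma bet_rec' (n l : ℕ) (_hn : 1 ≤ n) :
    lam n * (bet (n-1) l - bet n l) = - lam l * bet n l := by
  obtain ⟨k, rfl⟩ : ∃ k, n = k + 1 := ⟨n-1, by omega⟩
  have := bet_rec k l
  simp only [Nat.add_sub_cancel]
  linarith

lemma bet_tendsto (l : ℕ) : Filter.Tendsto (fun n => bet n l) Filter.atTop (nhds 1) := by
  have : Filter.Tendsto (fun n : ℕ => ∏ j ∈ range l, ((n : ℝ) - j) / (n + 2 + j)) Filter.atTop
      (nhds (∏ j ∈ range l, (1:ℝ))) := by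
    refine tendsto_finsetProd _ fun j _ => ?_
    have h : ∀ n : ℕ, ((n : ℝ) - j) / (n + 2 + j) = 1 - (2 + 2 * j) * (1 / ((n:ℝ) + (2 + j))) := by
      intro n
      have h1 : (n:ℝ) + 2 + j ≠ 0 := by positivity
      have h2 : (n:ℝ) + (2 + j) ≠ 0 := by positivity
      field_simp
      ring
    simp_rw [h]
    have h0 : Filter.Tendsto (fun n : ℕ => 1 / ((n:ℝ) + (2 + j))) Filter.atTop (nhds 0) := by
      have := (Filter.tendsto_atTop_add_const_right Filter.atTop (2 + (j:ℝ))
        tendsto_natCast_atTop_atTop).inv_tendsto_atTop (𝕜 := ℝ)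
      simp only [one_div]
      exact this
    simpa using (h0.const_mul (2 + 2 * (j:ℝ))).const_sub 1
  simpa [bet] using this

/-- absolute values of the coefficients of the shifted Legendre polynomial. -/
def dco (l k : ℕ) : ℝ := (l.choose k : ℝ) * ((l + k).choose l : ℝ)

lemma choose_rec (n k : ℕ) : ((n.choose (k+1) : ℕ) : ℝ) * (k+1) = (n.choose k : ℝ) * ((n:ℝ) - k) := by
  rcases lt_or_ge n k with h | h
  · rw [Nat.choose_eq_zero_of_lt h, Nat.choose_eq_zero_of_lt (by omega)]; simp
  · have := Nat.choose_succ_right_eq n k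
    have h2 : ((n - k : ℕ) : ℝ) = (n:ℝ) - k := by rw [Nat.cast_sub h]
    rw [← h2]; exact_mod_cast this

lemma dco_rec (l k : ℕ) : ((k:ℝ)+1)^2 * dco l (k+1) = (lam l - lam k) * dco l k := by
  have h1 := choose_rec l k
  have h2 : ((l + (k+1)).choose l : ℝ) * (k+1) = ((l+k).choose l : ℝ) * (l + k + 1) := by
    have := Nat.add_one_mul_choose_eq (l+k) k
    have e1 : (l+k).choose k = (l+k).choose l := by
      rw [Nat.choose_symm_add]
    have e2 : (l + k).succ.choose k.succ = (l + (k+1)).choose l := by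
      have := Nat.choose_symm_add (a := l) (b := k+1)
      rw [this]; rfl
    rw [e1, e2] at this
    have : ((l + k).succ : ℝ) * ((l+k).choose l : ℝ) = ((l + (k+1)).choose l : ℝ) * (k.succ : ℝ) := by
      exact_mod_cast this
    push_cast at this
    linarith
  unfold dco lam
  calc _ = (((l.choose (k+1) : ℕ) : ℝ) * (k+1)) * (((l + (k+1)).choose l : ℝ) * (k+1)) := by ring
    _ = _ := by rw [h1, h2]; ring

lemma tele_zero (n L : ℕ) : ∑ l ∈ range L, (2 * (l:ℝ) + 1) * bet n l
    = (n + 1) - (n + 1 + L) * bet n L := by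
  induction L with
  | zero => simp [bet_zero]
  | succ L ih =>
    rw [sum_range_succ, ih, bet_succ]
    have : (n:ℝ) + 2 + L ≠ 0 := by positivity
    push_cast
    field_simp
    ring

lemma sum_ext (n : ℕ) (c : ℕ → ℝ) :
    ∑ l ∈ range (n+2), bet n l * c l = ∑ l ∈ range (n+1), bet n l * c l := by
  rw [sum_range_succ, bet_eq_zero (by omega : n < n+1)]; simp

lemma sum_dco (k : ℕ) : ∀ n : ℕ, ∑ l ∈ range (n+1), bet n l * ((2 * (l:ℝ) + 1) * dco l k)
    = (n + 1) * (n.choose k : ℝ) := by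
  induction k with
  | zero =>
    intro n
    have := tele_zero n (n+1)
    rw [bet_eq_zero (by omega : n < n+1)] at this
    simp [dco]
    simp at this
    rw [← this]
    exact sum_congr rfl fun _ _ => by ring
  | succ k ih =>
    intro n
    have hk : ((k:ℝ)+1)^2 ≠ 0 := by positivity
    apply mul_left_cancel₀ hk
    have e1 : ((k:ℝ)+1)^2 * ∑ l ∈ range (n+1), bet n l * ((2 * (l:ℝ) + 1) * dco l (k+1))
        = ∑ l ∈ range (n+1), (lam l * bet n l) * ((2 * (l:ℝ) + 1) * dco l k)
          - lam k * ∑ l ∈ range (n+1), bet n l * ((2 * (l:ℝ) + 1) * dco l k) := by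
      rw [mul_sum, mul_sum, ← sum_sub_distrib]
      refine sum_congr rfl fun l _ => ?_
      calc _ = bet n l * (2 * (l:ℝ) + 1) * (((k:ℝ)+1)^2 * dco l (k+1)) := by ring
        _ = _ := by rw [dco_rec]; ring
    rw [e1, ih]
    rcases n with _ | n
    · simp [lam, bet_zero]
      rcases k with _ | k
      · simp
      · simp
    · have e2 : ∑ l ∈ range (n+1+1), (lam l * bet (n+1) l) * ((2 * (l:ℝ) + 1) * dco l k)
          = lam (n+1) * (∑ l ∈ range (n+1+1), bet (n+1) l * ((2 * (l:ℝ) + 1) * dco l k)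
            - ∑ l ∈ range (n+1), bet n l * ((2 * (l:ℝ) + 1) * dco l k)) := by
        rw [← sum_ext n, ← sum_sub_distrib, mul_sum]
        refine sum_congr rfl fun l _ => ?_
        have := bet_rec n l
        have h : lam l * bet (n+1) l = lam (n+1) * (bet (n+1) l - bet n l) := by linarith
        rw [h]; ring
      rw [e2, ih, ih]
      have h1 := choose_rec (n+1) k
      have h3 : ((n+1).choose k : ℝ) * ((n:ℝ)+1-k) = (n.choose k : ℝ) * (n+1) := by
        rcases lt_or_ge n k with h | h
        · rw [Nat.choose_eq_zero_of_lt h]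
          rcases Nat.lt_or_ge (n+1) k with h' | h'
          · rw [Nat.choose_eq_zero_of_lt h']; simp
          · obtain rfl : k = n+1 := by omega
            push_cast; ring
        · have h2 : ((n + 1 - k : ℕ) : ℝ) = (n:ℝ) + 1 - k := by
            rw [Nat.cast_sub (by omega)]; push_cast; ring
          have h4 := Nat.choose_mul_succ_eq n k
          have h4' : (n.choose k : ℝ) * ((n:ℝ)+1) = ((n+1).choose k : ℝ) * ((n+1-k : ℕ):ℝ) := by
            exact_mod_cast h4
          rw [h4', h2]
      have h5 : ((k:ℝ)+1)^2 * (((n+1:ℕ):ℝ)+1) * ((n+1).choose (k+1) : ℝ)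
          = ((k:ℝ)+1) * ((n:ℝ)+2) * (((n+1).choose (k+1) : ℝ) * (k+1)) := by push_cast; ring
      rw [← mul_assoc (((k:ℝ)+1)^2), h5, h1]
      unfold lam
      push_cast
      linear_combination ((n+1)*(n+2)) * h3

section poly
open Polynomial

/-- The real linear polynomial `(1 - X)/2`. -/
def Wp : ℝ[X] := C (1/2) * (1 - X)

lemma deriv_Wp : derivative Wp = C (-1/2) := by
  simp [Wp]
  rw [← C_neg]; congr 1; norm_num

lemma eval_Wp (u : ℝ) : Wp.eval u = (1 - u)/2 := by simp [Wp]; ring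

lemma iter_deriv_comp (p : ℝ[X]) (n : ℕ) :
    derivative^[n] (p.comp Wp) = C ((-1/2)^n) * (derivative^[n] p).comp Wp := by
  induction n generalizing p with
  | zero => simp
  | succ n ih =>
    rw [Function.iterate_succ_apply', ih, derivative_mul, derivative_C, derivative_comp, deriv_Wp,
      Function.iterate_succ_apply', pow_succ, C_mul]
    ring

lemma legendreP_eq (l : ℕ) :
    legendreP l = ((shiftedLegendre l).map (Int.castRingHom ℝ)).comp Wp := by
  have h := congrArg (Polynomial.map (Int.castRingHom ℝ)) (factorial_mul_shiftedLegendre_eq l)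
  rw [Polynomial.map_mul, ← iterate_derivative_map] at h
  simp only [Polynomial.map_natCast, Polynomial.map_mul, Polynomial.map_pow, Polynomial.map_sub,
    Polynomial.map_one, map_X] at h
  have h2 := iter_deriv_comp (X ^ l * (1 - X) ^ l) l
  rw [← h] at h2
  have e : (X ^ l * (1 - X) ^ l : ℝ[X]).comp Wp = C ((-1/4)^l) * (X^2 - 1)^l := by
    simp only [mul_comp, pow_comp, X_comp, sub_comp, one_comp]
    rw [← mul_pow, C_pow, ← mul_pow]
    congr 1
    unfold Wp
    have : (1 : ℝ[X]) = C (1/2) + C (1/2) := by rw [← C_add]; norm_num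
    have h4 : (C (-1/4) : ℝ[X]) = - (C (1/2) * C (1/2)) := by
      rw [← C_mul, ← C_neg]; norm_num
    have hh : C (1/2 : ℝ) * 2 = 1 := by
      have : (2:ℝ[X]) = C 2 := rfl
      rw [this, ← C_mul]; norm_num
    rw [h4]
    linear_combination (-(1 - X) * C (1/2 : ℝ)) * hh
  rw [e, iterate_derivative_C_mul] at h2
  have h3 : derivative^[l] ((X^2 - 1 : ℝ[X])^l) =
      C (2^l * (l.factorial : ℝ)) * ((shiftedLegendre l).map (Int.castRingHom ℝ)).comp Wp := by
    have hc : (C ((-4 : ℝ)^l) : ℝ[X]) * C ((-1/4)^l) = 1 := by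
      rw [← C_mul, ← mul_pow]; norm_num
    calc _ = C ((-4 : ℝ)^l) * (C ((-1/4)^l) * derivative^[l] ((X^2 - 1 : ℝ[X])^l)) := by
          rw [← mul_assoc, hc, one_mul]
      _ = _ := by
          rw [h2, mul_comp, natCast_comp, ← mul_assoc, ← C_mul, ← mul_pow, ← mul_assoc, C_mul]
          norm_num
  unfold legendreP
  rw [h3, ← mul_assoc, ← C_mul, inv_mul_cancel₀ (by positivity)]
  simp

lemma legendreP_sum (l : ℕ) :
    legendreP l = ∑ k ∈ range (l+1), C ((-1)^k * dco l k) * Wp^k := by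
  rw [legendreP_eq, shiftedLegendre]
  simp [Polynomial.map_sum, dco, Polynomial.sum_comp]
  refine sum_congr rfl fun k _ => ?_
  ring

/-- Legendre differential operator. -/
def Leg (p : ℝ[X]) : ℝ[X] := (1 - X^2) * derivative (derivative p) - 2 * X * derivative p

lemma Leg_add (p q : ℝ[X]) : Leg (p + q) = Leg p + Leg q := by
  simp [Leg]; ring

lemma Leg_C_mul (c : ℝ) (p : ℝ[X]) : Leg (C c * p) = C c * Leg p := by
  simp [Leg]; ring

lemma Leg_sum (s : Finset ℕ) (f : ℕ → ℝ[X]) : Leg (∑ k ∈ s, f k) = ∑ k ∈ s, Leg (f k) := by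
  classical
  induction s using Finset.induction_on with
  | empty => simp [Leg]
  | insert a s ha ih => rw [sum_insert ha, sum_insert ha, Leg_add, ih]

/-- The real linear polynomial `(1 + X)/2`. -/
def Vp : ℝ[X] := C (1/2) * (1 + X)

lemma deriv_Vp : derivative Vp = C (1/2) := by
  simp [Vp]

lemma eval_Vp (u : ℝ) : Vp.eval u = (1 + u)/2 := by simp [Vp]; ring

lemma Leg_eval_pow (q : ℝ[X]) (d : ℝ) (hd : derivative q = C d) (k : ℕ) (u : ℝ) :
    (Leg (q^(k+1))).eval u = (1 - u^2) * ((k+1) * k * (q.eval u)^(k-1) * d^2)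
      - 2 * u * ((k+1) * (q.eval u)^k * d) := by
  unfold Leg
  have h1 : derivative (q^(k+1)) = C ((k+1) * d) * q^k := by
    rw [derivative_pow_succ, hd]
    simp
    ring
  rw [h1, derivative_C_mul, derivative_pow, hd]
  simp
  ring

lemma Leg_Wp (k : ℕ) (u : ℝ) : (Leg (Wp^k)).eval u =
    (k:ℝ)^2 * (Wp.eval u)^(k-1) - k * (k+1) * (Wp.eval u)^k := by
  rcases k with _ | k
  · simp [Leg]
  · rw [Leg_eval_pow Wp _ deriv_Wp, eval_Wp]
    rcases k with _ | k
    · simp; ring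
    · simp only [Nat.add_sub_cancel]
      push_cast
      ring

lemma Leg_Vp (k : ℕ) (u : ℝ) : (Leg (Vp^k)).eval u =
    (k:ℝ)^2 * (Vp.eval u)^(k-1) - k * (k+1) * (Vp.eval u)^k := by
  rcases k with _ | k
  · simp [Leg]
  · rw [Leg_eval_pow Vp _ deriv_Vp, eval_Vp]
    rcases k with _ | k
    · simp; ring
    · simp only [Nat.add_sub_cancel]
      push_cast
      ring

lemma Leg_legendre (l : ℕ) (u : ℝ) :
    (Leg (legendreP l)).eval u = - lam l * (legendreP l).eval u := by
  rw [legendreP_sum, Leg_sum]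
  simp only [Leg_C_mul, eval_finsetSum, eval_mul, eval_C, Leg_Wp, eval_pow]
  set w := Wp.eval u
  have e1 : ∑ k ∈ range (l+1), (-1)^k * dco l k * ((k:ℝ)^2 * w^(k-1) - k * (k+1) * w^k)
      = ∑ k ∈ range (l+1), (-1)^k * dco l k * ((k:ℝ)^2 * w^(k-1))
        - ∑ k ∈ range (l+1), (-1)^k * dco l k * (lam k * w^k) := by
    rw [← sum_sub_distrib]
    exact sum_congr rfl fun k _ => by unfold lam; ring
  have e2 : ∑ k ∈ range (l+1), (-1)^k * dco l k * ((k:ℝ)^2 * w^(k-1))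
      = ∑ k ∈ range (l+1), (-1)^(k+1) * ((lam l - lam k) * dco l k) * w^k := by
    have hz : (lam l - lam l) = 0 := sub_self _
    rw [sum_range_succ', sum_range_succ (fun k => (-1)^(k+1) * ((lam l - lam k) * dco l k) * w^k)]
    simp only [sub_self, zero_mul, mul_zero, add_zero]
    simp
    refine sum_congr rfl fun k _ => ?_
    rw [← dco_rec]; ring
  rw [e1, e2, mul_sum, ← sum_sub_distrib]
  exact sum_congr rfl fun k _ => by ring

lemma legendre_one (l : ℕ) : (legendreP l).eval 1 = 1 := by
  rw [legendreP_sum, eval_finsetSum, sum_eq_single 0]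
  · simp [dco]
  · intro b _ hb
    simp [eval_Wp, hb]
  · simp

lemma kernel_expand (n : ℕ) (u : ℝ) :
    ((n:ℝ) + 1) * ((1 + u)/2)^n
      = ∑ l ∈ range (n+1), bet n l * ((2 * (l:ℝ) + 1) * (legendreP l).eval u) := by
  have hx : (1+u)/2 = (-Wp.eval u) + 1 := by rw [eval_Wp]; ring
  have e : ∀ l ∈ range (n+1), (legendreP l).eval u
      = ∑ k ∈ range (n+1), (-1)^k * dco l k * (Wp.eval u)^k := by
    intro l hl
    rw [legendreP_sum, eval_finsetSum]
    simp only [eval_mul, eval_C, eval_pow]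
    refine sum_subset (range_mono (by have := mem_range.1 hl; omega)) ?_
    intro k _ hk
    have : dco l k = 0 := by
      unfold dco
      rw [Nat.choose_eq_zero_of_lt (by simpa using hk)]; simp
    rw [this]; simp
  rw [hx, add_pow, mul_sum]
  have : ∀ l ∈ range (n+1), bet n l * ((2 * (l:ℝ) + 1) * (legendreP l).eval u)
      = ∑ k ∈ range (n+1), ((-1)^k * (Wp.eval u)^k) * (bet n l * ((2 * (l:ℝ) + 1) * dco l k)) := by
    intro l hl
    rw [e l hl, mul_sum, mul_sum]
    exact sum_congr rfl fun k _ => by ring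
  rw [sum_congr rfl this, sum_comm]
  refine sum_congr rfl fun k _ => ?_
  rw [← mul_sum, sum_dco, neg_pow]
  ring

end poly
end WCE
end

end

section
open MeasureTheory Real Metric
open scoped ENNReal RealInnerProductSpace Manifold

noncomputable section
namespace WCE
open Finset

/-- Auxiliary recursive solution of the pure death chain started at `m`. -/
def Qc (m : ℕ) : ℕ → ℝ → ℝ
  | 0 => fun t => Real.exp (-(lam m) * t)
  | j+1 => fun t => Real.exp (-(lam (m-(j+1))) * t) *
      ∫ τ in (0:ℝ)..t, Real.exp (lam (m-(j+1)) * τ) * (lam (m-j) * Qc m j τ)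

lemma Qc_cont (m j : ℕ) : Continuous (Qc m j) := by
  induction j with
  | zero => unfold Qc; fun_prop
  | succ j ih =>
    have : Continuous fun t => ∫ τ in (0:ℝ)..t, Real.exp (lam (m-(j+1)) * τ) * (lam (m-j) * Qc m j τ) := by
      apply intervalIntegral.continuous_primitive
      intro a b
      exact Continuous.intervalIntegrable (by fun_prop) _ _
    unfold Qc
    fun_prop

lemma Qc_deriv_zero (m : ℕ) (t : ℝ) : HasDerivAt (Qc m 0) (-(lam m) * Qc m 0 t) t := by
  have h : HasDerivAt (fun t : ℝ => -(lam m) * t) (-(lam m)) t := by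
    simpa using (hasDerivAt_id t).const_mul (-(lam m))
  have := h.exp
  simp only [Qc]
  convert this using 1
  ring

lemma Qc_deriv_succ (m j : ℕ) (t : ℝ) : HasDerivAt (Qc m (j+1))
    (lam (m-j) * Qc m j t - lam (m-(j+1)) * Qc m (j+1) t) t := by
  have hc := Qc_cont m j
  have h : HasDerivAt (fun t : ℝ => -(lam (m-(j+1))) * t) (-(lam (m-(j+1)))) t := by
    simpa using (hasDerivAt_id t).const_mul (-(lam (m-(j+1))))
  have h1 := h.exp
  have h2 : HasDerivAt (fun t => ∫ τ in (0:ℝ)..t, Real.exp (lam (m-(j+1)) * τ) * (lam (m-j) * Qc m j τ))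
      (Real.exp (lam (m-(j+1)) * t) * (lam (m-j) * Qc m j t)) t := by
    apply intervalIntegral.integral_hasDerivAt_right
    · exact Continuous.intervalIntegrable (by fun_prop) _ _
    · exact Continuous.stronglyMeasurableAtFilter (by fun_prop) _ _
    · exact Continuous.continuousAt (by fun_prop)
  have h3 := h1.mul h2
  have he : Real.exp (-(lam (m-(j+1))) * t) * Real.exp (lam (m-(j+1)) * t) = 1 := by
    rw [← Real.exp_add]; simp
  rw [show Qc m (j+1) = fun t => Real.exp (-(lam (m-(j+1))) * t) *
      ∫ τ in (0:ℝ)..t, Real.exp (lam (m-(j+1)) * τ) * (lam (m-j) * Qc m j τ) from rfl]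
  refine h3.congr_deriv ?_
  linear_combination (lam (m-j) * Qc m j t) * he

lemma Qc_nonneg (m j : ℕ) {t : ℝ} (ht : 0 ≤ t) : 0 ≤ Qc m j t := by
  induction j generalizing t with
  | zero => simp only [Qc]; positivity
  | succ j ih =>
    simp only [Qc]
    refine mul_nonneg (Real.exp_pos _).le ?_
    apply intervalIntegral.integral_nonneg ht
    intro u hu
    exact mul_nonneg (Real.exp_pos _).le (mul_nonneg (lam_nonneg _) (ih hu.1))

/-- The death chain. -/
def qc (m n : ℕ) (t : ℝ) : ℝ := if n ≤ m then Qc m (m - n) t else 0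

lemma qc_nonneg (m n : ℕ) {t : ℝ} (ht : 0 ≤ t) : 0 ≤ qc m n t := by
  unfold qc; split_ifs
  · exact Qc_nonneg _ _ ht
  · rfl

lemma qc_zero (m n : ℕ) : qc m n 0 = if n = m then 1 else 0 := by
  unfold qc
  rcases lt_trichotomy n m with h | h | h
  · obtain ⟨j, hj⟩ : ∃ j, m - n = j + 1 := ⟨m - n - 1, by omega⟩
    rw [if_pos h.le, if_neg h.ne, hj]
    simp [Qc]
  · subst h; simp [Qc]
  · rw [if_neg (by omega), if_neg (by omega)]

lemma qc_deriv (m n : ℕ) (hn : n ≤ m) (t : ℝ) :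
    HasDerivAt (qc m n) (lam (n+1) * qc m (n+1) t - lam n * qc m n t) t := by
  have e : qc m n = Qc m (m-n) := by funext t; simp [qc, hn]
  rcases hn.eq_or_lt with h | h
  · subst h
    have e2 : qc n (n+1) t = 0 := by simp [qc]
    rw [e2, e]
    simpa using Qc_deriv_zero n t
  · obtain ⟨j, hj⟩ : ∃ j, m - n = j + 1 := ⟨m - n - 1, by omega⟩
    have e2 : qc m (n+1) t = Qc m j t := by
      unfold qc; rw [if_pos (by omega)]; congr 1; omega
    rw [e2, e, hj]
    have := Qc_deriv_succ m j t
    rwa [show m - j = n + 1 by omega, show m - (j+1) = n by omega] at this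

/-- Expectation of `c` under the chain. -/
def Ex (m : ℕ) (c : ℕ → ℝ) (t : ℝ) : ℝ := ∑ n ∈ range (m+1), qc m n t * c n

lemma Ex_zero (m : ℕ) (c : ℕ → ℝ) : Ex m c 0 = c m := by
  unfold Ex
  rw [sum_eq_single m]
  · simp [qc_zero]
  · intro b _ hb; simp [qc_zero, hb]
  · simp

lemma Ex_deriv (m : ℕ) (c : ℕ → ℝ) (t : ℝ) :
    HasDerivAt (Ex m c) (Ex m (fun n => lam n * (c (n-1) - c n)) t) t := by
  have h : HasDerivAt (Ex m c)
      (∑ n ∈ range (m+1), (lam (n+1) * qc m (n+1) t - lam n * qc m n t) * c n) t := by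
    unfold Ex
    have := HasDerivAt.sum (u := range (m+1)) (A := fun n t => qc m n t * c n) (x := t)
      (A' := fun n => (lam (n+1) * qc m (n+1) t - lam n * qc m n t) * c n)
      (fun n hn => (qc_deriv m n (by have := mem_range.1 hn; omega) t).mul_const (c n))
    have e : (fun t => ∑ n ∈ range (m+1), qc m n t * c n)
        = ∑ n ∈ range (m+1), fun t => qc m n t * c n := by
      funext t; simp only [Finset.sum_apply]
    rw [e]; exact this
  refine h.congr_deriv ?_
  have e1 : ∑ n ∈ range (m+1), lam (n+1) * qc m (n+1) t * c n
      = ∑ n ∈ range (m+1), lam n * qc m n t * c (n-1) := by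
    have h1 := sum_range_succ' (fun n => lam n * qc m n t * c (n-1)) (m+1)
    have h2 := sum_range_succ (fun n => lam n * qc m n t * c (n-1)) (m+1)
    have hq : qc m (m+1) t = 0 := by simp [qc]
    rw [h2, hq] at h1
    simp [lam] at h1
    simp [lam]
    exact h1.symm
  unfold Ex
  simp only [sub_mul, sum_sub_distrib]
  rw [e1, ← sum_sub_distrib]
  exact sum_congr rfl fun n _ => by ring

lemma Ex_mono (m : ℕ) {c d : ℕ → ℝ} {t : ℝ} (ht : 0 ≤ t) (h : ∀ n, c n ≤ d n) :
    Ex m c t ≤ Ex m d t :=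
  sum_le_sum fun n _ => mul_le_mul_of_nonneg_left (h n) (qc_nonneg m n ht)

lemma Ex_nonneg (m : ℕ) {d : ℕ → ℝ} {t : ℝ} (ht : 0 ≤ t) (h : ∀ n, 0 ≤ d n) :
    0 ≤ Ex m d t :=
  sum_nonneg fun n _ => mul_nonneg (qc_nonneg m n ht) (h n)

lemma Ex_lin (m : ℕ) (c d : ℕ → ℝ) (a b t : ℝ) :
    a * Ex m c t + b * Ex m d t = Ex m (fun n => a * c n + b * d n) t := by
  unfold Ex
  rw [mul_sum, mul_sum, ← sum_add_distrib]
  exact sum_congr rfl fun n _ => by ring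

lemma Ex_bet (m l : ℕ) (t : ℝ) : Ex m (fun n => bet n l) t = bet m l * Real.exp (-(lam l * t)) := by
  have hd : ∀ t, HasDerivAt (Ex m (fun n => bet n l)) (-(lam l) * Ex m (fun n => bet n l) t) t := by
    intro t
    refine (Ex_deriv m _ t).congr_deriv ?_
    unfold Ex
    rw [mul_sum]
    refine sum_congr rfl fun n _ => ?_
    have : lam n * (bet (n-1) l - bet n l) = - lam l * bet n l := by
      rcases n with _ | n
      · rcases l with _ | l
        · simp [lam]
        · rw [bet_eq_zero (Nat.succ_pos l)]; simp [lam]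
      · exact bet_rec' (n+1) l (by omega)
    show qc m n t * (lam n * (bet (n-1) l - bet n l)) = -lam l * (qc m n t * bet n l)
    rw [this]; ring
  have hE : ∀ t, HasDerivAt (fun t => Real.exp (lam l * t)) (Real.exp (lam l * t) * lam l) t := by
    intro t
    have : HasDerivAt (fun t : ℝ => lam l * t) (lam l) t := by
      simpa using (hasDerivAt_id t).const_mul (lam l)
    exact this.exp
  have hP : ∀ t, HasDerivAt (fun t => Ex m (fun n => bet n l) t * Real.exp (lam l * t)) 0 t := by
    intro t
    refine ((hd t).mul (hE t)).congr_deriv ?_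
    ring
  have := is_const_of_deriv_eq_zero (fun t => (hP t).differentiableAt) (fun t => (hP t).deriv) t 0
  simp only [mul_zero, Real.exp_zero, mul_one, Ex_zero] at this
  rw [← this, Real.exp_neg, mul_assoc, mul_inv_cancel₀ (Real.exp_pos _).ne', mul_one]

lemma mono_of_deriv {f f' : ℝ → ℝ} (h : ∀ t, HasDerivAt f (f' t) t) (h0 : ∀ t, 0 ≤ t → 0 ≤ f' t)
    {a b : ℝ} (ha : 0 ≤ a) (hab : a ≤ b) : f a ≤ f b := by
  have : MonotoneOn f (Set.Ici 0) := by
    apply monotoneOn_of_deriv_nonneg (convex_Ici 0)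
    · exact fun t _ => (h t).continuousAt.continuousWithinAt
    · exact fun t _ => (h t).differentiableAt.differentiableWithinAt
    · intro t ht
      rw [(h t).deriv]
      exact h0 t (by simpa using interior_subset ht)
  exact this ha (ha.trans hab) hab

/-- Shifted time. -/
def Tm (m : ℕ) (t : ℝ) : ℝ := t + 1 / ((m:ℝ) + 1)

lemma Tm_pos (m : ℕ) {t : ℝ} (ht : 0 ≤ t) : 0 < Tm m t := by unfold Tm; positivity

lemma Tm_deriv (m : ℕ) (t : ℝ) : HasDerivAt (Tm m) 1 t := by
  unfold Tm; exact (hasDerivAt_id t).add_const _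

lemma Phi_nonneg (m : ℕ) {t : ℝ} (ht : 0 ≤ t) :
    0 ≤ Ex m (fun n => ((n:ℝ)+1) * (1 - Tm m t * n)) t := by
  set c0 : ℕ → ℝ := fun n => (n:ℝ) + 1
  set c1 : ℕ → ℝ := fun n => (n:ℝ) * (n + 1)
  have hF : ∀ t, HasDerivAt (fun t => Tm m t ^ 2 * Ex m c0 t - Tm m t ^ 3 * Ex m c1 t)
      (2 * Tm m t * Ex m (fun n => ((n:ℝ)+1) * (1 - Tm m t * n)^2) t) t := by
    intro t
    have hT := Tm_deriv m t
    refine (((hT.pow 2).mul (Ex_deriv m c0 t)).sub ((hT.pow 3).mul (Ex_deriv m c1 t))).congr_deriv ?_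
    unfold Ex
    simp only [mul_sum]
    simp only [← sum_add_distrib, ← sum_sub_distrib]
    refine sum_congr rfl fun n _ => ?_
    rcases n with _ | n
    · simp [c0, c1, lam]
    · simp only [c0, c1, lam, Nat.add_sub_cancel, Pi.pow_apply]; push_cast; ring
  have h := mono_of_deriv hF (fun t ht => mul_nonneg (mul_nonneg (by norm_num) (Tm_pos m ht).le)
    (Ex_nonneg m ht fun n => by positivity)) le_rfl ht
  have h0 : 0 ≤ Tm m 0 ^ 2 * Ex m c0 0 - Tm m 0 ^ 3 * Ex m c1 0 := by
    rw [Ex_zero, Ex_zero]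
    have : Tm m 0 * ((m:ℝ)+1) = 1 := by unfold Tm; field_simp; try ring
    have hT := Tm_pos m (le_refl 0)
    have e : Tm m 0 ^ 2 * c0 m - Tm m 0 ^ 3 * c1 m = Tm m 0 * (1 - Tm m 0 * m) := by
      simp only [c0, c1]
      linear_combination (Tm m 0 - (Tm m 0)^2 * m) * this
    rw [e]
    refine mul_nonneg hT.le ?_
    nlinarith
  have h1 : Tm m t ^ 2 * Ex m c0 t - Tm m t ^ 3 * Ex m c1 t =
      Tm m t ^ 2 * Ex m (fun n => ((n:ℝ)+1) * (1 - Tm m t * n)) t := by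
    have := Ex_lin m c0 c1 (Tm m t ^ 2) (-Tm m t ^ 3) t
    have e : Tm m t ^ 2 * Ex m (fun n => ((n:ℝ)+1) * (1 - Tm m t * n)) t
       = Ex m (fun n => (Tm m t ^ 2) * c0 n + (-Tm m t ^ 3) * c1 n) t := by
      unfold Ex
      rw [mul_sum]
      exact sum_congr rfl fun n _ => by simp only [c0, c1]; ring
    rw [e, ← this]; ring
  have h2 : 0 ≤ Tm m t ^ 2 * Ex m (fun n => ((n:ℝ)+1) * (1 - Tm m t * n)) t := by
    rw [← h1]; exact h0.trans h
  exact nonneg_of_mul_nonneg_right h2 (pow_pos (Tm_pos m ht) 2)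

lemma rpow_cmp {v T : ℝ} (hv0 : 0 ≤ v) (hv1 : v ≤ 1) (hT : 0 < T) (n : ℕ) :
    v ^ (1/T) * (1 - T * n) ≤ v ^ n * (1 - T * n) := by
  rcases hv0.eq_or_lt with h | h
  · subst h
    rw [Real.zero_rpow (by positivity)]
    rcases n with _ | n
    · simp
    · simp
  · rw [← Real.rpow_natCast]
    rcases le_total (n:ℝ) (1/T) with hn | hn
    · have h1 : v ^ (1/T) ≤ v ^ (n:ℝ) := Real.rpow_le_rpow_of_exponent_ge h hv1 hn
      have h2 : 0 ≤ 1 - T * n := by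
        rw [le_div_iff₀ hT] at hn; linarith
      exact mul_le_mul_of_nonneg_right h1 h2
    · have h1 : v ^ (n:ℝ) ≤ v ^ (1/T) := Real.rpow_le_rpow_of_exponent_ge h hv1 hn
      have h2 : 1 - T * n ≤ 0 := by
        rw [div_le_iff₀ hT] at hn; linarith
      exact mul_le_mul_of_nonpos_right h1 h2

/-- The Li–Yau type monotonicity. -/
lemma LiYau (m : ℕ) {v : ℝ} (hv0 : 0 ≤ v) (hv1 : v ≤ 1) {a b : ℝ} (ha : 0 ≤ a) (hab : a ≤ b) :
    Tm m a * Ex m (fun n => ((n:ℝ)+1) * v^n) a ≤ Tm m b * Ex m (fun n => ((n:ℝ)+1) * v^n) b := by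
  refine mono_of_deriv (f := fun t => Tm m t * Ex m (fun n => ((n:ℝ)+1) * v^n) t)
    (fun t => (Tm_deriv m t).mul (Ex_deriv m _ t)) ?_ ha hab
  intro t ht
  rw [Ex_lin]
  have hT := Tm_pos m ht
  have h1 : v ^ (1/Tm m t) * Ex m (fun n => ((n:ℝ)+1) * (1 - Tm m t * n)) t ≤
      Ex m (fun n => 1 * (((n:ℝ)+1) * v^n) + Tm m t * (lam n *
        ((((n-1:ℕ):ℝ)+1) * v^(n-1) - ((n:ℝ)+1) * v^n))) t := by
    have : v ^ (1/Tm m t) * Ex m (fun n => ((n:ℝ)+1) * (1 - Tm m t * n)) t =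
        Ex m (fun n => v ^ (1/Tm m t) * (((n:ℝ)+1) * (1 - Tm m t * n))) t := by
      unfold Ex; rw [mul_sum]; exact sum_congr rfl fun n _ => by ring
    rw [this]
    refine Ex_mono m ht fun n => ?_
    have h2 := mul_le_mul_of_nonneg_left (rpow_cmp hv0 hv1 hT n) (by positivity : (0:ℝ) ≤ (n:ℝ)+1)
    refine le_trans (by linarith) (h2.trans ?_)
    rcases n with _ | n
    · simp [lam]
    · simp only [Nat.add_sub_cancel, lam]
      push_cast
      have h3 : v^(n+1) ≤ v^n := pow_le_pow_of_le_one hv0 hv1 (Nat.le_succ n)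
      have h4 : 0 ≤ Tm m t * ((n:ℝ)+1) * ((n:ℝ)+1+1) * ((n:ℝ)+1) * (v^n - v^(n+1)) := by
        have : 0 ≤ v^n - v^(n+1) := by linarith
        positivity
      nlinarith
  exact le_trans (mul_nonneg (Real.rpow_nonneg hv0 _) (Phi_nonneg m ht)) h1

end WCE
end

end

section
open MeasureTheory Real Metric
open scoped ENNReal RealInnerProductSpace Manifold

noncomputable section
namespace WCE
open Finset

section compare
variable {ι : Type*} [Fintype ι]

/-- Truncated trace of the heat flow. -/
def Gh (b : ℕ → ℝ) (m : ℕ) (t : ℝ) : ℝ :=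
  ∑ l ∈ range (m+1), bet m l * Real.exp (-(lam l * t)) * b l

/-- `Gh` without the constant mode. -/
def gh (b : ℕ → ℝ) (m : ℕ) (t : ℝ) : ℝ :=
  ∑ l ∈ range m, bet m (l+1) * Real.exp (-(lam (l+1) * t)) * b (l+1)

lemma Gh_eq_gh (b : ℕ → ℝ) (hb0 : b 0 = 1) (m : ℕ) (t : ℝ) : Gh b m t = gh b m t + 1 := by
  unfold Gh gh
  rw [sum_range_succ', bet_zero, hb0]
  simp [lam]

lemma Gh_eq (b : ℕ → ℝ) (w v : ι → ℝ)
    (hb : ∀ n : ℕ, ∑ l ∈ range (n+1), bet n l * b l = ∑ i, w i * (((n:ℝ)+1) * v i ^ n))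
    (m : ℕ) (t : ℝ) : Gh b m t = ∑ i, w i * Ex m (fun n => ((n:ℝ)+1) * v i ^ n) t := by
  have h1 : ∀ n ∈ range (m+1), ∑ l ∈ range (m+1), bet n l * b l
      = ∑ i, w i * (((n:ℝ)+1) * v i ^ n) := by
    intro n hn
    rw [← hb n]
    symm
    have hn' : n + 1 ≤ m + 1 := by have := mem_range.1 hn; omega
    refine sum_subset (range_subset_range.2 hn') fun l _ hl => ?_
    rw [bet_eq_zero (by have := mem_range.not.1 hl; omega)]; simp
  calc Gh b m t = ∑ l ∈ range (m+1), Ex m (fun n => bet n l) t * b l := by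
        unfold Gh; exact sum_congr rfl fun l _ => by rw [Ex_bet]
    _ = ∑ n ∈ range (m+1), qc m n t * ∑ l ∈ range (m+1), bet n l * b l := by
        unfold Ex
        simp only [sum_mul, mul_sum]
        rw [sum_comm]
        exact sum_congr rfl fun n _ => sum_congr rfl fun l _ => by ring
    _ = ∑ n ∈ range (m+1), qc m n t * ∑ i, w i * (((n:ℝ)+1) * v i ^ n) :=
        sum_congr rfl fun n hn => by rw [h1 n hn]
    _ = _ := by
        unfold Ex
        simp only [mul_sum]
        rw [sum_comm]
        exact sum_congr rfl fun n _ => sum_congr rfl fun l _ => by ring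

lemma Gh_mono (b : ℕ → ℝ) (w v : ι → ℝ)
    (hb : ∀ n : ℕ, ∑ l ∈ range (n+1), bet n l * b l = ∑ i, w i * (((n:ℝ)+1) * v i ^ n))
    (hw : ∀ i, 0 ≤ w i) (hv0 : ∀ i, 0 ≤ v i) (hv1 : ∀ i, v i ≤ 1)
    (m : ℕ) {t t0 : ℝ} (ht : 0 ≤ t) (h : t ≤ t0) :
    Tm m t * Gh b m t ≤ Tm m t0 * Gh b m t0 := by
  rw [Gh_eq b w v hb, Gh_eq b w v hb, mul_sum, mul_sum]
  refine sum_le_sum fun i _ => ?_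
  have := mul_le_mul_of_nonneg_left (LiYau m (hv0 i) (hv1 i) ht h) (hw i)
  linarith

lemma gh_nonneg {b : ℕ → ℝ} (hb : ∀ l, 0 ≤ b l) (m : ℕ) (t : ℝ) : 0 ≤ gh b m t :=
  sum_nonneg fun l _ => mul_nonneg (mul_nonneg (bet_nonneg _ _) (Real.exp_pos _).le) (hb _)

lemma integrable_gamma {a r : ℝ} (ha : 0 < a) (hr : 0 < r) :
    IntegrableOn (fun t : ℝ => t ^ (a - 1) * Real.exp (-(r * t))) (Set.Ioi 0) := by
  refine Integrable.of_integral_ne_zero ?_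
  rw [Real.integral_rpow_mul_exp_neg_mul_Ioi ha hr]
  have := Real.Gamma_pos_of_pos ha
  positivity

lemma gh_integrable (b : ℕ → ℝ) (m : ℕ) {a : ℝ} (ha : 0 < a) :
    IntegrableOn (fun t : ℝ => t ^ (a - 1) * gh b m t) (Set.Ioi 0) := by
  have : (fun t : ℝ => t ^ (a - 1) * gh b m t) = fun t => ∑ l ∈ range m,
      (t ^ (a - 1) * Real.exp (-(lam (l+1) * t))) * (bet m (l+1) * b (l+1)) := by
    funext t; unfold gh; rw [mul_sum]; exact sum_congr rfl fun l _ => by ring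
  rw [this]
  exact integrable_finsetSum _ fun l _ => (integrable_gamma ha (lam_pos (by omega))).mul_const _

lemma gh_integral (b : ℕ → ℝ) (m : ℕ) {a : ℝ} (ha : 0 < a) :
    ∫ t in Set.Ioi (0:ℝ), t ^ (a - 1) * gh b m t =
      Real.Gamma a * ∑ l ∈ range m, bet m (l+1) * (lam (l+1) ^ (-a) * b (l+1)) := by
  have : (fun t : ℝ => t ^ (a - 1) * gh b m t) = fun t => ∑ l ∈ range m,
      (t ^ (a - 1) * Real.exp (-(lam (l+1) * t))) * (bet m (l+1) * b (l+1)) := by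
    funext t; unfold gh; rw [mul_sum]; exact sum_congr rfl fun l _ => by ring
  rw [this, integral_finsetSum _ fun l _ =>
    (integrable_gamma ha (lam_pos (by omega))).mul_const _, mul_sum]
  refine sum_congr rfl fun l _ => ?_
  have hl : 0 < lam (l+1) := lam_pos (by omega)
  rw [integral_mul_const, Real.integral_rpow_mul_exp_neg_mul_Ioi ha hl, one_div,
    Real.inv_rpow hl.le, Real.rpow_neg hl.le]
  ring

lemma rpow_exp_le {s x : ℝ} (hs : 0 < s) (hx : 0 < x) :
    x ^ s * Real.exp (-x) ≤ s ^ s * Real.exp (-s) := by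
  rw [Real.rpow_def_of_pos hx, Real.rpow_def_of_pos hs, ← Real.exp_add, ← Real.exp_add]
  apply Real.exp_le_exp.2
  have := Real.log_le_sub_one_of_pos (div_pos hx hs)
  rw [Real.log_div hx.ne' hs.ne'] at this
  have h2 := mul_le_mul_of_nonneg_left this hs.le
  have : s * (x / s - 1) = x - s := by field_simp
  nlinarith

lemma gh_le {b : ℕ → ℝ} (hb : ∀ l, 0 ≤ b l) (m : ℕ) {s t0 V : ℝ} (hs : 0 < s) (ht0 : 0 < t0)
    (hV : ∀ L, ∑ l ∈ range L, lam (l+1) ^ (-s) * b (l+1) ≤ V) :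
    gh b m t0 ≤ s ^ s * Real.exp (-s) * t0 ^ (-s) * V := by
  have h1 : gh b m t0 ≤ ∑ l ∈ range m,
      s ^ s * Real.exp (-s) * t0 ^ (-s) * (lam (l+1) ^ (-s) * b (l+1)) := by
    refine sum_le_sum fun l _ => ?_
    have hl : 0 < lam (l+1) := lam_pos (by omega)
    have h := rpow_exp_le hs (mul_pos hl ht0)
    rw [Real.mul_rpow hl.le ht0.le] at h
    have hp : 0 < lam (l+1) ^ s := Real.rpow_pos_of_pos hl _
    have hq : 0 < t0 ^ s := Real.rpow_pos_of_pos ht0 _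
    have h2 : Real.exp (-(lam (l+1) * t0)) ≤
        s ^ s * Real.exp (-s) * t0 ^ (-s) * lam (l+1) ^ (-s) := by
      rw [Real.rpow_neg hl.le, Real.rpow_neg ht0.le, mul_assoc, ← mul_inv, ← div_eq_mul_inv,
        le_div_iff₀ (by positivity)]
      linarith
    have h3 := mul_le_mul_of_nonneg_right h2 (hb (l+1))
    have h4 : bet m (l+1) * Real.exp (-(lam (l+1) * t0)) ≤ Real.exp (-(lam (l+1) * t0)) :=
      mul_le_of_le_one_left (Real.exp_pos _).le (bet_le_one _ _)
    have h5 := mul_le_mul_of_nonneg_right h4 (hb (l+1))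
    linarith
  rw [← mul_sum] at h1
  exact h1.trans (mul_le_mul_of_nonneg_left (hV m) (by positivity))

lemma pointwise_bound (b : ℕ → ℝ) (hb0 : b 0 = 1) (hbn : ∀ l, 0 ≤ b l) (w v : ι → ℝ)
    (hb : ∀ n : ℕ, ∑ l ∈ range (n+1), bet n l * b l = ∑ i, w i * (((n:ℝ)+1) * v i ^ n))
    (hw : ∀ i, 0 ≤ w i) (hv0 : ∀ i, 0 ≤ v i) (hv1 : ∀ i, v i ≤ 1)
    (m : ℕ) {t t0 s s' : ℝ} (ht : 0 < t) (ht0 : 0 < t0) (hss : s' < s) :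
    t ^ (s' - 1) * gh b m t ≤ t0 ^ (s' - s) * (t ^ (s - 1) * gh b m t) +
      (Set.Ioc 0 t0).indicator (fun t => t ^ (s' - 2) * (Tm m t0 * Gh b m t0)) t := by
  have hg := gh_nonneg hbn m t
  rcases le_or_gt t t0 with h | h
  · rw [Set.indicator_of_mem (show t ∈ Set.Ioc 0 t0 from ⟨ht, h⟩)]
    have h1 := Gh_mono b w v hb hw hv0 hv1 m ht.le h
    have h2 : t * gh b m t ≤ Tm m t * Gh b m t := by
      rw [Gh_eq_gh b hb0]
      have : t ≤ Tm m t := by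
        unfold Tm
        have : (0:ℝ) ≤ 1 / ((m:ℝ)+1) := by positivity
        linarith
      have h3 := mul_le_mul_of_nonneg_right this hg
      have := Tm_pos m ht.le
      linarith
    have h3 : t ^ (s' - 1) = t ^ (s' - 2) * t := by
      rw [show s' - 1 = (s' - 2) + 1 by ring, Real.rpow_add ht, Real.rpow_one]
    have h4 : 0 ≤ t0 ^ (s' - s) * (t ^ (s - 1) * gh b m t) := by positivity
    have h5 := mul_le_mul_of_nonneg_left (h2.trans h1) (Real.rpow_nonneg ht.le (s'-2))
    rw [h3]; linarith
  · rw [Set.indicator_of_notMem (by simp; intro _; exact h), add_zero]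
    have h1 : t ^ (s' - s) ≤ t0 ^ (s' - s) :=
      Real.rpow_le_rpow_of_nonpos ht0 h.le (by linarith)
    have h2 : t ^ (s' - 1) = t ^ (s' - s) * t ^ (s - 1) := by
      rw [← Real.rpow_add ht]; ring_nf
    rw [h2, mul_assoc]
    exact mul_le_mul_of_nonneg_right h1 (by positivity)

lemma compare_m (b : ℕ → ℝ) (hb0 : b 0 = 1) (hbn : ∀ l, 0 ≤ b l) (w v : ι → ℝ)
    (hb : ∀ n : ℕ, ∑ l ∈ range (n+1), bet n l * b l = ∑ i, w i * (((n:ℝ)+1) * v i ^ n))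
    (hw : ∀ i, 0 ≤ w i) (hv0 : ∀ i, 0 ≤ v i) (hv1 : ∀ i, v i ≤ 1)
    (m : ℕ) {t0 s s' V : ℝ} (ht0 : 0 < t0) (hs' : 1 < s') (hss : s' < s)
    (hV : ∀ L, ∑ l ∈ range L, lam (l+1) ^ (-s) * b (l+1) ≤ V) :
    Real.Gamma s' * ∑ l ∈ range m, bet m (l+1) * (lam (l+1) ^ (-s') * b (l+1)) ≤
      t0 ^ (s' - s) * (Real.Gamma s * V) + t0 ^ (s' - 1) / (s' - 1) *
        (Tm m t0 * (1 + s ^ s * Real.exp (-s) * t0 ^ (-s) * V)) := by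
  have hs0 : 0 < s := by linarith
  rw [← gh_integral b m (by linarith : 0 < s')]
  have hii : IntegrableOn (fun t : ℝ => t ^ (s' - 2) * (Tm m t0 * Gh b m t0)) (Set.Ioc 0 t0) := by
    have := (intervalIntegral.intervalIntegrable_rpow' (a := 0) (b := t0) (r := s' - 2) (by linarith))
    rw [intervalIntegrable_iff_integrableOn_Ioc_of_le ht0.le] at this
    exact this.mul_const _
  have hind : IntegrableOn ((Set.Ioc 0 t0).indicator
      (fun t : ℝ => t ^ (s' - 2) * (Tm m t0 * Gh b m t0))) (Set.Ioi 0) :=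
    ((integrable_indicator_iff measurableSet_Ioc).2 hii).integrableOn
  have h1 : ∫ t in Set.Ioi (0:ℝ), t ^ (s' - 1) * gh b m t ≤
      ∫ t in Set.Ioi (0:ℝ), (t0 ^ (s' - s) * (t ^ (s - 1) * gh b m t) +
      (Set.Ioc 0 t0).indicator (fun t => t ^ (s' - 2) * (Tm m t0 * Gh b m t0)) t) := by
    refine setIntegral_mono_on (gh_integrable b m (by linarith))
      (((gh_integrable b m hs0).const_mul _).add hind) measurableSet_Ioi fun t ht => ?_
    exact pointwise_bound b hb0 hbn w v hb hw hv0 hv1 m ht ht0 hss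
  refine h1.trans ?_
  rw [integral_add ((gh_integrable b m hs0).const_mul _) hind, integral_const_mul,
    gh_integral b m hs0, setIntegral_indicator measurableSet_Ioc]
  have e1 : Set.Ioi (0:ℝ) ∩ Set.Ioc 0 t0 = Set.Ioc 0 t0 := by
    ext x; simp
  rw [e1, integral_mul_const, ← intervalIntegral.integral_of_le ht0.le,
    integral_rpow (Or.inl (by linarith)), Real.zero_rpow (by linarith), sub_zero,
    show s' - 2 + 1 = s' - 1 by ring]
  have hG := Real.Gamma_pos_of_pos hs0
  have hsum : ∑ l ∈ range m, bet m (l+1) * (lam (l+1) ^ (-s) * b (l+1)) ≤ V := by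
    refine le_trans (sum_le_sum fun l _ => ?_) (hV m)
    exact mul_le_of_le_one_left (mul_nonneg (Real.rpow_nonneg (lam_nonneg _) _) (hbn _))
      (bet_le_one _ _)
  have hT := Tm_pos m ht0.le
  have hG2 : Gh b m t0 ≤ 1 + s ^ s * Real.exp (-s) * t0 ^ (-s) * V := by
    rw [Gh_eq_gh b hb0]
    have := gh_le hbn m hs0 ht0 hV
    linarith
  have hs1 : 0 < s' - 1 := by linarith
  gcongr

lemma compare (b : ℕ → ℝ) (hb0 : b 0 = 1) (hbn : ∀ l, 0 ≤ b l) (w v : ι → ℝ)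
    (hb : ∀ n : ℕ, ∑ l ∈ range (n+1), bet n l * b l = ∑ i, w i * (((n:ℝ)+1) * v i ^ n))
    (hw : ∀ i, 0 ≤ w i) (hv0 : ∀ i, 0 ≤ v i) (hv1 : ∀ i, v i ≤ 1)
    {t0 s s' V : ℝ} (ht0 : 0 < t0) (hs' : 1 < s') (hss : s' < s)
    (hV : ∀ L, ∑ l ∈ range L, lam (l+1) ^ (-s) * b (l+1) ≤ V) (L : ℕ) :
    Real.Gamma s' * ∑ l ∈ range L, lam (l+1) ^ (-s') * b (l+1) ≤
      t0 ^ (s' - s) * (Real.Gamma s * V) + t0 ^ (s' - 1) / (s' - 1) *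
        (t0 * (1 + s ^ s * Real.exp (-s) * t0 ^ (-s) * V)) := by
  have hT : Filter.Tendsto (fun m => Tm m t0) Filter.atTop (nhds t0) := by
    have := (tendsto_one_div_add_atTop_nhds_zero_nat (𝕜 := ℝ)).const_add t0
    simpa [Tm] using this
  have hl : Filter.Tendsto (fun m => Real.Gamma s' *
      ∑ l ∈ range L, bet m (l+1) * (lam (l+1) ^ (-s') * b (l+1))) Filter.atTop
      (nhds (Real.Gamma s' * ∑ l ∈ range L, 1 * (lam (l+1) ^ (-s') * b (l+1)))) :=
    (tendsto_finsetSum _ fun l _ => (bet_tendsto (l+1)).mul_const _).const_mul _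
  have hr := (((hT.mul_const (1 + s ^ s * Real.exp (-s) * t0 ^ (-s) * V)).const_mul
    (t0 ^ (s' - 1) / (s' - 1)))).const_add (t0 ^ (s' - s) * (Real.Gamma s * V))
  simp only [one_mul] at hl
  refine le_of_tendsto_of_tendsto hl hr ?_
  filter_upwards [Filter.eventually_ge_atTop L] with m hm
  refine le_trans ?_ (compare_m b hb0 hbn w v hb hw hv0 hv1 m ht0 hs' hss hV)
  refine mul_le_mul_of_nonneg_left ?_ (Real.Gamma_pos_of_pos (by linarith)).le
  exact sum_le_sum_of_subset_of_nonneg (range_subset_range.2 hm) fun l _ _ =>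
    mul_nonneg (bet_nonneg _ _) (mul_nonneg (Real.rpow_nonneg (lam_nonneg _) _) (hbn _))

end compare
end WCE
end

end

section
open MeasureTheory Real Metric
open scoped ENNReal RealInnerProductSpace Manifold

noncomputable section
namespace WCE
open Finset

open scoped ContDiff Pointwise

/-- Continuous functions on the sphere are integrable. -/
lemma int_of_cont {f : S2 → ℝ} (hf : Continuous f) : Integrable f sphereArea := by
  have := hf.continuousOn.integrableOn_compact (μ := sphereArea) (isCompact_univ)
  rwa [integrableOn_univ] at this

lemma norm_S2 (x : S2) : ‖(x : E3)‖ = 1 := by simpa using x.2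

lemma ne_zero_S2 (x : S2) : (x : E3) ≠ 0 := by
  intro h; have := norm_S2 x; rw [h] at this; simp at this

section rot
variable (J : E3 →L[ℝ] E3)

/-- One-parameter group generated by `J`. -/
def rot (θ : ℝ) : E3 →L[ℝ] E3 := NormedSpace.exp (θ • J)

lemma rot_zero : rot J 0 = 1 := by 
  have h : (0:ℝ) • J = 0 := by ext x; simp
  unfold rot; rw [h]; exact NormedSpace.exp_zero

lemma rot_deriv (x : E3) (θ : ℝ) : HasDerivAt (fun θ => rot J θ x) (J (rot J θ x)) θ := by
  have h := hasDerivAt_exp_smul_const' (𝕂 := ℝ) J θ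
  have h2 := h.clm_apply (hasDerivAt_const θ x)
  simpa [rot] using h2

lemma rot_norm (hJ : ∀ x, ⟪J x, x⟫ = 0) (θ : ℝ) (x : E3) : ‖rot J θ x‖ = ‖x‖ := by
  have hd : ∀ θ, HasDerivAt (fun θ => ‖rot J θ x‖ ^ 2) 0 θ := by
    intro θ
    refine (rot_deriv J x θ).norm_sq.congr_deriv ?_
    rw [real_inner_comm, hJ]; simp
  have := is_const_of_deriv_eq_zero (fun t => (hd t).differentiableAt) (fun t => (hd t).deriv) θ 0
  simp only [rot_zero, one_apply_eq_self] at this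
  exact (sq_eq_sq₀ (norm_nonneg _) (norm_nonneg _)).1 this

/-- The group element as an isometry. -/
def rotI (hJ : ∀ x, ⟪J x, x⟫ = 0) (θ : ℝ) : E3 ≃ₗᵢ[ℝ] E3 :=
  LinearIsometry.toLinearIsometryEquiv ⟨(rot J θ : E3 →ₗ[ℝ] E3), rot_norm J hJ θ⟩ rfl

lemma rotI_apply (hJ : ∀ x, ⟪J x, x⟫ = 0) (θ : ℝ) (x : E3) : rotI J hJ θ x = rot J θ x := rfl

end rot

/-- Isometry acting on the sphere. -/
def actS (R : E3 ≃ₗᵢ[ℝ] E3) (x : S2) : S2 := ⟨R x, by simp⟩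

lemma actS_cont (R : E3 ≃ₗᵢ[ℝ] E3) : Continuous (actS R) := by
  unfold actS; exact Continuous.subtype_mk (R.continuous.comp continuous_subtype_val) _

lemma actS_mp (R : E3 ≃ₗᵢ[ℝ] E3) : MeasurePreserving (actS R) sphereArea sphereArea := by
  refine ⟨(actS_cont R).measurable, ?_⟩
  ext s hs
  rw [Measure.map_apply (actS_cont R).measurable hs,
    Measure.toSphere_apply' _ ((actS_cont R).measurable hs), Measure.toSphere_apply' _ hs]
  congr 1
  rw [← R.measurePreserving.measure_preimage_emb R.toHomeomorph.measurableEmbedding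
    (Set.Ioo (0:ℝ) 1 • Subtype.val '' s)]
  congr 1
  ext z
  simp only [Set.mem_smul, Set.mem_image, Set.mem_preimage]
  constructor
  · rintro ⟨a, ha, y, ⟨x, hx, rfl⟩, rfl⟩
    exact ⟨a, ha, R x, ⟨actS R x, hx, rfl⟩, by simp⟩
  · rintro ⟨a, ha, y, ⟨x, hx, rfl⟩, h⟩
    refine ⟨a, ha, R.symm x, ⟨⟨R.symm x, by simp⟩, ?_, rfl⟩, ?_⟩
    · have : actS R ⟨R.symm x, by simp⟩ = x := by ext1; simp [actS]
      rw [this]; exact hx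
    · apply R.injective; rw [← h]; simp

lemma actS_int (R : E3 ≃ₗᵢ[ℝ] E3) {f : S2 → ℝ} (hf : Continuous f) :
    ∫ x, f (actS R x) ∂sphereArea = ∫ x, f x ∂sphereArea := by
  have h := actS_mp R
  conv_rhs => rw [← h.map_eq]
  rw [integral_map h.measurable.aemeasurable hf.aestronglyMeasurable]

/-- Smoothness away from the origin. -/
def Sm (F : E3 → ℝ) : Prop := ∀ x, x ≠ 0 → ContDiffAt ℝ ∞ F x

lemma Sm.diff {F : E3 → ℝ} (hF : Sm F) {x : E3} (hx : x ≠ 0) : DifferentiableAt ℝ F x :=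
  (hF x hx).differentiableAt (by simp)

lemma Sm.cont {F : E3 → ℝ} (hF : Sm F) : Continuous (fun x : S2 => F x) := by
  rw [continuous_iff_continuousAt]
  intro x
  exact ContinuousAt.comp (f := ((↑) : S2 → E3)) (hF x (ne_zero_S2 x)).continuousAt
    continuous_subtype_val.continuousAt

lemma Sm.mul {F G : E3 → ℝ} (hF : Sm F) (hG : Sm G) : Sm (fun x => F x * G x) :=
  fun x hx => (hF x hx).mul (hG x hx)

lemma Sm.add {F G : E3 → ℝ} (hF : Sm F) (hG : Sm G) : Sm (fun x => F x + G x) :=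
  fun x hx => (hF x hx).add (hG x hx)

lemma Sm.neg {F : E3 → ℝ} (hF : Sm F) : Sm (fun x => - F x) :=
  fun x hx => (hF x hx).neg

/-- Directional derivative along the linear field `J`. -/
def Xd (J : E3 →L[ℝ] E3) (F : E3 → ℝ) (x : E3) : ℝ := fderiv ℝ F x (J x)

lemma Sm.xd {F : E3 → ℝ} (hF : Sm F) (J : E3 →L[ℝ] E3) : Sm (Xd J F) := by
  intro x hx
  unfold Xd
  exact ((hF x hx).fderiv_right (m := ∞) (by simp)).clm_apply J.contDiff.contDiffAt

lemma Xd_mul {F G : E3 → ℝ} (hF : Sm F) (hG : Sm G) (J : E3 →L[ℝ] E3) {x : E3} (hx : x ≠ 0) :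
    Xd J (fun x => F x * G x) x = F x * Xd J G x + G x * Xd J F x := by
  unfold Xd
  rw [fderiv_fun_mul (hF.diff hx) (hG.diff hx)]
  simp

lemma Xd_integral {F : E3 → ℝ} (hF : Sm F) (J : E3 →L[ℝ] E3) (hJ : ∀ x, ⟪J x, x⟫ = 0) :
    ∫ x : S2, Xd J F x ∂sphereArea = 0 := by
  obtain ⟨C, hC⟩ := (isCompact_univ (X := S2)).exists_bound_of_continuousOn
    (hF.xd J).cont.continuousOn
  have key := (hasDerivAt_integral_of_dominated_loc_of_deriv_le (μ := sphereArea)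
    (F := fun θ (x : S2) => F (actS (rotI J hJ θ) x)) (x₀ := (0:ℝ)) (s := Set.univ)
    (F' := fun θ (x : S2) => Xd J F (actS (rotI J hJ θ) x)) (bound := fun _ => C)
    Filter.univ_mem
    (Filter.Eventually.of_forall fun θ => (hF.cont.comp (actS_cont _)).aestronglyMeasurable)
    (int_of_cont (hF.cont.comp (actS_cont _)))
    ((hF.xd J).cont.comp (actS_cont _)).aestronglyMeasurable
    (Filter.Eventually.of_forall fun x θ _ => hC _ (Set.mem_univ _))
    (integrable_const _)
    (Filter.Eventually.of_forall fun x θ _ => by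
      have h1 : HasFDerivAt F (fderiv ℝ F (actS (rotI J hJ θ) x)) (rot J θ x) :=
        (hF.diff (ne_zero_S2 (actS (rotI J hJ θ) x))).hasFDerivAt
      exact h1.comp_hasDerivAt θ (rot_deriv J x θ))).2
  have h2 : (fun θ => ∫ x : S2, F (actS (rotI J hJ θ) x) ∂sphereArea)
      = fun _ => ∫ x : S2, F x ∂sphereArea := by
    funext θ; exact actS_int (rotI J hJ θ) hF.cont
  rw [h2] at key
  have h3 := key.unique (hasDerivAt_const _ _)
  rw [actS_int (rotI J hJ 0) (hF.xd J).cont] at h3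
  exact h3

lemma Xd_ibp {F G : E3 → ℝ} (hF : Sm F) (hG : Sm G) (J : E3 →L[ℝ] E3) (hJ : ∀ x, ⟪J x, x⟫ = 0) :
    ∫ x : S2, Xd J F x * G x ∂sphereArea = - ∫ x : S2, F x * Xd J G x ∂sphereArea := by
  have h := Xd_integral (hF.mul hG) J hJ
  have e : ∀ x : S2, Xd J (fun x => F x * G x) x = F x * Xd J G x + Xd J F x * G x := fun x => by
    rw [Xd_mul hF hG J (ne_zero_S2 x)]; ring
  simp_rw [e] at h
  rw [integral_add (int_of_cont (hF.mul (hG.xd J)).cont)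
    (int_of_cont ((hF.xd J).mul hG).cont)] at h
  linarith

/-- The three rotation generators. -/
def Jg : Fin 3 → E3 →L[ℝ] E3 := fun a =>
  LinearMap.toContinuousLinearMap (Matrix.toEuclideanLin
    (match a with
    | 0 => !![0,0,0;0,0,-1;0,1,0]
    | 1 => !![0,0,1;0,0,0;-1,0,0]
    | 2 => !![0,-1,0;1,0,0;0,0,0]))

lemma Jg0 (x : E3) : Jg 0 x = !₂[0, -x 2, x 1] := by
  ext i; fin_cases i <;> simp [Jg, Matrix.toEuclideanLin, Matrix.mulVec, dotProduct, Fin.sum_univ_three]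

lemma Jg1 (x : E3) : Jg 1 x = !₂[x 2, 0, -x 0] := by
  ext i; fin_cases i <;> simp [Jg, Matrix.toEuclideanLin, Matrix.mulVec, dotProduct, Fin.sum_univ_three]

lemma Jg2 (x : E3) : Jg 2 x = !₂[-x 1, x 0, 0] := by
  ext i; fin_cases i <;> simp [Jg, Matrix.toEuclideanLin, Matrix.mulVec, dotProduct, Fin.sum_univ_three]

lemma inner3 (x y : E3) : ⟪x, y⟫ = x 0 * y 0 + x 1 * y 1 + x 2 * y 2 := by
  simp [PiLp.inner_apply, Fin.sum_univ_three]; ring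

lemma Jg_skew (a : Fin 3) (x : E3) : ⟪Jg a x, x⟫ = 0 := by
  fin_cases a <;> simp [Jg0, Jg1, Jg2, inner3] <;> ring

lemma Jg_sq (x y : E3) : ∑ a, ⟪Jg a x, y⟫ ^ 2 = ⟪x, x⟫ * ⟪y, y⟫ - ⟪x, y⟫ ^ 2 := by
  rw [Fin.sum_univ_three]
  rw [inner3 x x, inner3 y y]
  simp [Jg0, Jg1, Jg2, inner3]; ring

lemma Jg_Jg (x y : E3) : ∑ a, ⟪Jg a (Jg a x), y⟫ = -2 * ⟪x, y⟫ := by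
  rw [Fin.sum_univ_three]
  simp [Jg0, Jg1, Jg2, inner3]; ring

/-- The spherical Laplacian. -/
def Lap (F : E3 → ℝ) (x : E3) : ℝ := ∑ a, Xd (Jg a) (Xd (Jg a) F) x

lemma Sm.lap {F : E3 → ℝ} (hF : Sm F) : Sm (Lap F) := by
  intro x hx
  exact ContDiffAt.sum fun a _ => ((hF.xd (Jg a)).xd (Jg a)) x hx

lemma Lap_symm {F G : E3 → ℝ} (hF : Sm F) (hG : Sm G) :
    ∫ x : S2, Lap F x * G x ∂sphereArea = ∫ x : S2, F x * Lap G x ∂sphereArea := by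
  unfold Lap
  simp_rw [sum_mul, mul_sum]
  rw [integral_finsetSum _ fun a _ => int_of_cont (((hF.xd (Jg a)).xd (Jg a)).mul hG).cont,
    integral_finsetSum _ fun a _ => int_of_cont (hF.mul ((hG.xd (Jg a)).xd (Jg a))).cont]
  refine sum_congr rfl fun a _ => ?_
  rw [Xd_ibp (hF.xd _) hG _ (Jg_skew a)]
  have := Xd_ibp hF (hG.xd (Jg a)) _ (Jg_skew a)
  linarith

lemma zon_sm (p : Polynomial ℝ) (y : E3) : Sm (fun x => p.eval ⟪x, y⟫) := by
  intro x _
  have h1 : ContDiff ℝ ∞ (fun u : ℝ => p.eval u) := Polynomial.contDiff_aeval p ∞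
  have h2 : ContDiff ℝ ∞ (fun x : E3 => ⟪x, y⟫) := contDiff_id.inner ℝ contDiff_const
  exact (h1.comp h2).contDiffAt

lemma zon_Xd (p : Polynomial ℝ) (y x : E3) (J : E3 →L[ℝ] E3) :
    Xd J (fun x => p.eval ⟪x, y⟫) x = p.derivative.eval ⟪x, y⟫ * ⟪J x, y⟫ := by
  unfold Xd
  have h2 : HasFDerivAt (fun x : E3 => ⟪x, y⟫) ((innerSL ℝ y : E3 →L[ℝ] ℝ)) x := by
    have := (innerSL ℝ y : E3 →L[ℝ] ℝ).hasFDerivAt (x := x)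
    refine this.congr_of_eventuallyEq (Filter.Eventually.of_forall fun z => ?_)
    simp [real_inner_comm]
  have h := (p.hasDerivAt ⟪x, y⟫).comp_hasFDerivAt x h2
  have h3 : HasFDerivAt (fun x : E3 => p.eval ⟪x, y⟫)
    (p.derivative.eval ⟪x, y⟫ • (innerSL ℝ y : E3 →L[ℝ] ℝ)) x := h
  rw [h3.fderiv]
  simp [real_inner_comm]

lemma lin_sm (J : E3 →L[ℝ] E3) (y : E3) : Sm (fun x => ⟪J x, y⟫) := by
  intro x _
  exact (J.contDiff.inner ℝ contDiff_const).contDiffAt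

lemma lin_Xd (J : E3 →L[ℝ] E3) (y x : E3) : Xd J (fun x => ⟪J x, y⟫) x = ⟪J (J x), y⟫ := by
  unfold Xd
  have h2 : HasFDerivAt (fun x : E3 => ⟪J x, y⟫) ((innerSL ℝ y : E3 →L[ℝ] ℝ).comp J) x := by
    have := ((innerSL ℝ y : E3 →L[ℝ] ℝ).comp J).hasFDerivAt (x := x)
    refine this.congr_of_eventuallyEq (Filter.Eventually.of_forall fun z => ?_)
    simp [real_inner_comm]
  rw [h2.fderiv]
  simp [real_inner_comm]

lemma zon_Lap (p : Polynomial ℝ) (x y : S2) :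
    Lap (fun x => p.eval ⟪x, (y : E3)⟫) x = (Leg p).eval ⟪(x : E3), (y : E3)⟫ := by
  unfold Lap
  have e : ∀ a, Xd (Jg a) (Xd (Jg a) (fun x => p.eval ⟪x, (y : E3)⟫)) x =
      p.derivative.eval ⟪(x : E3), (y : E3)⟫ * ⟪Jg a (Jg a x), (y : E3)⟫ +
      p.derivative.derivative.eval ⟪(x : E3), (y : E3)⟫ * ⟪Jg a x, (y : E3)⟫ ^ 2 := by
    intro a
    have h1 : Xd (Jg a) (fun x => p.eval ⟪x, (y : E3)⟫) =
        fun x => p.derivative.eval ⟪x, (y : E3)⟫ * ⟪Jg a x, (y : E3)⟫ := by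
      funext z; rw [zon_Xd]
    rw [h1, Xd_mul (zon_sm _ _) (lin_sm _ _) _ (ne_zero_S2 x), lin_Xd, zon_Xd]
    ring
  simp_rw [e]
  rw [sum_add_distrib, ← mul_sum, ← mul_sum, Jg_sq, Jg_Jg, real_inner_self_eq_norm_sq,
    real_inner_self_eq_norm_sq, norm_S2, norm_S2]
  unfold Leg
  simp
  ring

lemma smooth_ext {f : S2 → ℝ} (hf : SmoothOnSphere f) : ∃ F : E3 → ℝ, Sm F ∧ ∀ x : S2, F x = f x := by
  classical
  let U : TopologicalSpace.Opens E3 := ⟨{x | x ≠ 0}, isOpen_ne⟩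
  let n : U → E3 := fun x => ‖(x : E3)‖⁻¹ • (x : E3)
  have hn : ∀ x, n x ∈ Metric.sphere (0 : E3) 1 := by
    intro x
    have : ‖(x : E3)‖ ≠ 0 := norm_ne_zero_iff.2 x.2
    simp [n, norm_smul, this]
  have hns : ContMDiff 𝓘(ℝ, E3) 𝓘(ℝ, E3) ∞ n := by
    intro x
    have h1 : ContDiffAt ℝ ∞ (fun x : E3 => ‖x‖⁻¹ • x) (x : E3) := by
      have hx : (x : E3) ≠ 0 := x.2
      exact ((contDiffAt_norm ℝ hx).inv (norm_ne_zero_iff.2 hx)).smul contDiffAt_id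
    exact (contMDiffAt_subtype_iff (f := fun x : E3 => ‖x‖⁻¹ • x)).2 h1.contMDiffAt
  have hc := hns.codRestrict_sphere (n := 2) hn
  have hfc := hf.comp hc
  let F : E3 → ℝ := fun x => if h : x ≠ 0 then f (Set.codRestrict n _ hn ⟨x, h⟩) else 0
  refine ⟨F, ?_, ?_⟩
  · intro x hx
    rw [← contMDiffAt_iff_contDiffAt]
    refine (contMDiffAt_subtype_iff (U := U) (x := ⟨x, hx⟩) (f := F)).1 ?_
    refine (hfc.contMDiffAt (x := ⟨x, hx⟩)).congr_of_eventuallyEq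
      (Filter.Eventually.of_forall fun z => ?_)
    have hz : (z : E3) ≠ 0 := z.2
    simp only [F]
    rw [dif_pos hz]; rfl
  · intro x
    simp only [F]
    rw [dif_pos (ne_zero_S2 x)]
    congr 1
    ext1
    simp [n, norm_S2]

lemma smooth_of_sm {F : E3 → ℝ} (hF : ContDiff ℝ ∞ F) : SmoothOnSphere (fun x : S2 => F x) := by
  unfold SmoothOnSphere
  exact hF.contMDiff.comp contMDiff_coe_sphere

end WCE
end

end

section
open MeasureTheory Real Metric
open scoped ENNReal RealInnerProductSpace Manifold

noncomputable section
namespace WCE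
open Finset

open scoped ContDiff

lemma area_univ : sphereArea.real Set.univ = 4 * π := by
  rw [measureReal_def, Measure.toSphere_apply_univ, EuclideanSpace.volume_ball_fin_three]
  have : (0:ℝ) ≤ π * 4 / 3 := by have := Real.pi_pos; positivity
  simp [ENNReal.toReal_mul, ENNReal.toReal_ofReal this]
  ring

lemma Lap_integral {F : E3 → ℝ} (hF : Sm F) : ∫ x : S2, Lap F x ∂sphereArea = 0 := by
  unfold Lap
  rw [integral_finsetSum _ fun a _ => int_of_cont ((hF.xd (Jg a)).xd (Jg a)).cont]
  exact sum_eq_zero fun a _ => Xd_integral (hF.xd _) _ (Jg_skew a)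

lemma int_v (n : ℕ) (y : S2) :
    ∫ x : S2, (Vp.eval ⟪(x : E3), (y : E3)⟫) ^ n ∂sphereArea = 4 * π / (n + 1) := by
  induction n with
  | zero => simp only [pow_zero, integral_const, area_univ, smul_eq_mul]; simp
  | succ n ih =>
    have h := Lap_integral (zon_sm (Vp ^ (n+1)) y)
    simp_rw [zon_Lap, Leg_Vp] at h
    have hc : ∀ k : ℕ, Integrable (fun x : S2 => (Vp.eval ⟪(x : E3), (y : E3)⟫) ^ k) sphereArea := by
      intro k
      have := (zon_sm (Vp ^ k) y).cont
      simp only [Polynomial.eval_pow] at this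
      exact int_of_cont this
    rw [integral_sub ((hc _).const_mul _) ((hc _).const_mul _), integral_const_mul,
      integral_const_mul, Nat.add_sub_cancel, ih] at h
    have hn : (0:ℝ) < (n:ℝ) + 1 := by positivity
    have hn2 : (0:ℝ) < (n:ℝ) + 1 + 1 := by positivity
    push_cast at h ⊢
    rw [eq_div_iff hn2.ne']
    field_simp at h
    have h' : ((n:ℝ) + 1) * ((∫ x : S2, (Vp.eval ⟪(x : E3), (y : E3)⟫) ^ (n+1) ∂sphereArea)
      * ((n:ℝ) + 1 + 1) - 4 * π) = 0 := by linarith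
    rcases mul_eq_zero.1 h' with h1 | h1
    · linarith
    · linarith

lemma Vp_eval (u : ℝ) : Vp.eval u = (1 + u) / 2 := by rw [eval_Vp]

lemma inner_cont : Continuous (fun p : S2 × S2 => ⟪(p.1 : E3), (p.2 : E3)⟫) :=
  (continuous_subtype_val.comp continuous_fst).inner (continuous_subtype_val.comp continuous_snd)

lemma inner_le (x y : S2) : ⟪(x : E3), (y : E3)⟫ ≤ 1 := by
  have := real_inner_le_norm (x : E3) (y : E3)
  rwa [norm_S2, norm_S2, one_mul] at this

lemma inner_ge (x y : S2) : -1 ≤ ⟪(x : E3), (y : E3)⟫ := by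
  have := (abs_le.1 (abs_real_inner_le_norm (x : E3) (y : E3))).1
  rwa [norm_S2, norm_S2, one_mul] at this

lemma inner_self (x : S2) : ⟪(x : E3), (x : E3)⟫ = 1 := by
  rw [real_inner_self_eq_norm_sq, norm_S2]; norm_num

lemma approx {f : S2 → ℝ} (hf : Continuous f) (x : S2) :
    Filter.Tendsto (fun n : ℕ => ((n:ℝ) + 1) / (4 * π) *
      ∫ y : S2, ((1 + ⟪(y : E3), (x : E3)⟫) / 2) ^ n * f y ∂sphereArea) Filter.atTop (nhds (f x)) := by
  have hc : Continuous (fun y : S2 => (1 + ⟪(y : E3), (x : E3)⟫) / 2) := by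
    have : Continuous (fun y : S2 => ⟪(y : E3), (x : E3)⟫) :=
      continuous_subtype_val.inner continuous_const
    fun_prop
  have h := tendsto_setIntegral_pow_smul_of_unique_maximum_of_isCompact_of_continuousOn
    (μ := sphereArea) (g := f) (x₀ := x) (s := Set.univ) isCompact_univ
    (c := fun y : S2 => (1 + ⟪(y : E3), (x : E3)⟫) / 2) hc.continuousOn
    (fun y _ hy => by
      have h1 : ⟪(y : E3), (x : E3)⟫ < 1 :=
        (inner_lt_one_iff_real_of_norm_eq_one (norm_S2 y) (norm_S2 x)).2 (fun h => hy (Subtype.ext h))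
      simp only [inner_self]; linarith)
    (fun y _ => by have := inner_ge y x; linarith)
    (by simp only [inner_self]; norm_num) (by simp) hf.continuousOn
  simp only [Measure.restrict_univ, smul_eq_mul] at h
  refine h.congr fun n => ?_
  have := int_v n x
  simp_rw [Vp_eval] at this
  rw [this, inv_div]

/-- Polynomial profile of the zonal kernel. -/
def zonP (l : ℕ) : Polynomial ℝ := Polynomial.C ((2 * l + 1 : ℝ) / (4 * π)) * legendreP l

lemma zonal_eq (l : ℕ) (x y : S2) : zonal l x y = (zonP l).eval ⟪(y : E3), (x : E3)⟫ := by
  unfold zonal zonP; rw [Polynomial.eval_mul, Polynomial.eval_C, real_inner_comm]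

lemma zonal_symm (l : ℕ) (x y : S2) : zonal l x y = zonal l y x := by
  unfold zonal; rw [real_inner_comm]

lemma zonal_cont (l : ℕ) : Continuous (fun p : S2 × S2 => zonal l p.1 p.2) := by
  unfold zonal
  exact continuous_const.mul ((legendreP l).continuous.comp inner_cont)

lemma zonal_cont1 (l : ℕ) (x : S2) : Continuous (fun y => zonal l x y) :=
  (zonal_cont l).comp (continuous_const.prodMk continuous_id)

lemma zonal_self (l : ℕ) (x : S2) : zonal l x x = (2 * l + 1 : ℝ) / (4 * π) := by
  unfold zonal; rw [inner_self, legendre_one, mul_one]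

lemma Leg_zonP (l : ℕ) (u : ℝ) : (Leg (zonP l)).eval u = - lam l * (zonP l).eval u := by
  have h := Leg_legendre l u
  unfold zonP Leg at *
  simp only [Polynomial.derivative_C_mul, Polynomial.eval_add, Polynomial.eval_sub,
    Polynomial.eval_mul, Polynomial.eval_C] at *
  linear_combination ((2 * l + 1 : ℝ) / (4 * π)) * h

lemma kernel_zonal (n : ℕ) (x y : S2) :
    ((n:ℝ) + 1) / (4 * π) * ((1 + ⟪(y : E3), (x : E3)⟫) / 2) ^ n
      = ∑ l ∈ range (n+1), bet n l * zonal l x y := by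
  have h := kernel_expand n ⟪(y : E3), (x : E3)⟫
  rw [div_mul_eq_mul_div, h, sum_div]
  refine sum_congr rfl fun l _ => ?_
  unfold zonal; rw [real_inner_comm]; ring

/-- Projection onto the degree `l` eigenspace. -/
def hl (l : ℕ) (f : S2 → ℝ) (x : S2) : ℝ := ∫ y, zonal l x y * f y ∂sphereArea

lemma hl_approx {f : S2 → ℝ} (hf : Continuous f) (x : S2) :
    Filter.Tendsto (fun n : ℕ => ∑ l ∈ range (n+1), bet n l * hl l f x)
      Filter.atTop (nhds (f x)) := by
  refine (approx hf x).congr fun n => ?_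
  rw [← integral_const_mul]
  unfold hl
  simp_rw [← integral_const_mul]
  have hi : ∀ l ∈ range (n+1),
      Integrable (fun y => bet n l * (zonal l x y * f y)) sphereArea := fun l _ =>
    int_of_cont (continuous_const.mul ((zonal_cont1 l x).mul hf))
  rw [← integral_finsetSum _ hi]
  refine integral_congr_ae (Filter.Eventually.of_forall fun y => ?_)
  show _ * (_ * f y) = _
  rw [← mul_assoc, kernel_zonal, sum_mul]
  exact sum_congr rfl fun l _ => by ring

lemma hl_Lap {F : E3 → ℝ} (hF : Sm F) (l : ℕ) (x : S2) :
    hl l (fun y => Lap F y) x = - lam l * hl l (fun y => F y) x := by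
  unfold hl
  simp_rw [zonal_eq]
  have h := Lap_symm (zon_sm (zonP l) x) hF
  rw [← h, ← integral_const_mul]
  refine integral_congr_ae (Filter.Eventually.of_forall fun y => ?_)
  show Lap (fun z => (zonP l).eval ⟪z, (x : E3)⟫) y * F y = _
  rw [zon_Lap, Leg_zonP]; ring

lemma hl_congr {f g : S2 → ℝ} (h : ∀ x, f x = g x) (l : ℕ) (x : S2) : hl l f x = hl l g x := by
  have : f = g := funext h
  rw [this]

lemma hl_smul (c : ℝ) (f : S2 → ℝ) (l : ℕ) (x : S2) :
    hl l (fun y => c * f y) x = c * hl l f x := by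
  unfold hl
  rw [← integral_const_mul]
  exact integral_congr_ae (Filter.Eventually.of_forall fun y => by ring)

lemma hl_eig_ne {F : E3 → ℝ} (hF : Sm F) {l k : ℕ} (hE : ∀ x : S2, Lap F x = - lam l * F x)
    (hk : k ≠ l) (x : S2) : hl k (fun y => F y) x = 0 := by
  have h := hl_Lap hF k x
  rw [hl_congr hE, hl_smul] at h
  have h2 : (lam k - lam l) * hl k (fun y => F y) x = 0 := by linarith
  rcases mul_eq_zero.1 h2 with h3 | h3
  · exact absurd (lam_inj (sub_eq_zero.1 h3)) hk
  · exact h3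

lemma hl_eig {F : E3 → ℝ} (hF : Sm F) {l : ℕ} (hE : ∀ x : S2, Lap F x = - lam l * F x)
    (x : S2) : hl l (fun y => F y) x = F x := by
  have h1 := hl_approx hF.cont x
  have h2 : Filter.Tendsto (fun n : ℕ => ∑ k ∈ range (n+1), bet n k * hl k (fun y : S2 => F y) x)
      Filter.atTop (nhds (1 * hl l (fun y => F y) x)) := by
    refine ((bet_tendsto l).mul_const _).congr' ?_
    filter_upwards [Filter.eventually_ge_atTop l] with n hn
    rw [sum_eq_single l]
    · intro k _ hk; rw [hl_eig_ne hF hE hk, mul_zero]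
    · intro h; exact absurd (mem_range.2 (by omega)) h
  rw [one_mul] at h2
  exact tendsto_nhds_unique h2 h1

lemma zonal_lap (l : ℕ) (y x : S2) :
    Lap (fun z => (zonP l).eval ⟪z, (y : E3)⟫) x = - lam l * (zonP l).eval ⟪(x : E3), (y : E3)⟫ := by
  rw [zon_Lap, Leg_zonP]

lemma hl_zonal (l : ℕ) (x y : S2) : hl l (fun z => zonal l y z) x = zonal l y x := by
  have := hl_eig (zon_sm (zonP l) y) (zonal_lap l y) x
  rw [zonal_eq l y x, ← this]
  exact hl_congr (fun z => zonal_eq l y z) l x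

lemma hl_zonal_ne {k l : ℕ} (h : k ≠ l) (x y : S2) : hl k (fun z => zonal l y z) x = 0 := by
  have := hl_eig_ne (zon_sm (zonP l) y) (zonal_lap l y) h x
  rw [← this]
  exact hl_congr (fun z => zonal_eq l y z) k x

lemma cs_int {f g : S2 → ℝ} (hf : Continuous f) (hg : Continuous g) :
    (∫ x, f x * g x ∂sphereArea) ^ 2 ≤ (∫ x, f x ^ 2 ∂sphereArea) * ∫ x, g x ^ 2 ∂sphereArea := by
  have i1 : Integrable (fun x => f x ^ 2) sphereArea := int_of_cont (hf.pow 2)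
  have i2 : Integrable (fun x => g x ^ 2) sphereArea := int_of_cont (hg.pow 2)
  have i3 : Integrable (fun x => f x * g x) sphereArea := int_of_cont (hf.mul hg)
  have key : ∀ t : ℝ, 0 ≤ (∫ x, g x ^ 2 ∂sphereArea) * (t * t) +
      (2 * ∫ x, f x * g x ∂sphereArea) * t + ∫ x, f x ^ 2 ∂sphereArea := by
    intro t
    have h : ∫ x, (f x + t * g x) ^ 2 ∂sphereArea = (∫ x, f x ^ 2 ∂sphereArea) +
        ((2 * t) * (∫ x, f x * g x ∂sphereArea) + (t * t) * ∫ x, g x ^ 2 ∂sphereArea) := by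
      have i4 : Integrable (fun x => 2 * t * (f x * g x) + t * t * g x ^ 2) sphereArea :=
        (i3.const_mul _).add (i2.const_mul _)
      rw [← integral_const_mul, ← integral_const_mul,
        ← integral_add (i3.const_mul _) (i2.const_mul _),
        ← integral_add i1 i4]
      exact integral_congr_ae (Filter.Eventually.of_forall fun y => by ring)
    have h2 : 0 ≤ ∫ x, (f x + t * g x) ^ 2 ∂sphereArea := integral_nonneg fun z => sq_nonneg _
    rw [h] at h2
    linarith
  have := discrim_le_zero key
  unfold discrim at this
  linarith

lemma zonal_abs (l : ℕ) (x y : S2) : |zonal l x y| ≤ (2 * l + 1 : ℝ) / (4 * π) := by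
  have hx := zonal_cont1 l x
  have hy := zonal_cont1 l y
  have e : ∀ x y : S2, ∫ z, zonal l x z * zonal l y z ∂sphereArea = zonal l x y := by
    intro x y
    have := hl_zonal l x y
    rw [zonal_symm l x y, ← this]; rfl
  have exx := e x x
  have eyy := e y y
  have exy := e x y
  rw [zonal_self] at exx eyy
  have h := cs_int hx hy
  simp only [pow_two (zonal l _ _)] at h
  rw [exx, eyy, exy, ← pow_two] at h
  have hp := Real.pi_pos
  exact abs_le_of_sq_le_sq h (by positivity)

end WCE
end

end

section
open MeasureTheory Real Metric
open scoped ENNReal RealInnerProductSpace Manifold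

noncomputable section
namespace WCE
open Finset

open scoped ContDiff

lemma swap_int {K : S2 → S2 → ℝ} (hK : Continuous (Function.uncurry K)) :
    ∫ x, ∫ y, K x y ∂sphereArea ∂sphereArea = ∫ y, ∫ x, K x y ∂sphereArea ∂sphereArea := by
  refine integral_integral_swap ?_
  have := hK.continuousOn.integrableOn_compact (μ := sphereArea.prod sphereArea) isCompact_univ
  rwa [integrableOn_univ] at this

lemma hl_cont (l : ℕ) {f : S2 → ℝ} (hf : Continuous f) : Continuous (hl l f) := by
  have : Continuous (Function.uncurry fun x y => zonal l x y * f y) :=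
    (zonal_cont l).mul (hf.comp continuous_snd)
  have h := continuous_parametric_integral_of_continuous (μ := sphereArea) this isCompact_univ
  simp only [Measure.restrict_univ] at h
  exact h

lemma hl_symm (l : ℕ) {f g : S2 → ℝ} (hf : Continuous f) (hg : Continuous g) :
    ∫ x, hl l f x * g x ∂sphereArea = ∫ x, f x * hl l g x ∂sphereArea := by
  unfold hl
  simp_rw [← integral_mul_const, ← integral_const_mul]
  rw [swap_int (K := fun x y => zonal l x y * f y * g x)
    (((zonal_cont l).mul (hf.comp continuous_snd)).mul (hg.comp continuous_fst))]
  refine integral_congr_ae (Filter.Eventually.of_forall fun y => ?_)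
  refine integral_congr_ae (Filter.Eventually.of_forall fun x => ?_)
  show zonal l x y * f y * g x = f y * (zonal l y x * g x)
  rw [zonal_symm]; ring

lemma hl_idem (l : ℕ) {f : S2 → ℝ} (hf : Continuous f) (x : S2) : hl l (hl l f) x = hl l f x := by
  have h := hl_symm l (zonal_cont1 l x) hf
  have e : hl l (hl l f) x = ∫ y, zonal l x y * hl l f y ∂sphereArea := rfl
  rw [e, ← h]
  simp_rw [hl_zonal]
  rfl

lemma levelSq_eq (l : ℕ) {f : S2 → ℝ} (hf : Continuous f) :
    levelSq l f = ∫ x, hl l f x ^ 2 ∂sphereArea := by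
  have h := hl_symm l hf (hl_cont l hf)
  simp_rw [hl_idem l hf] at h
  simp_rw [pow_two]
  rw [h]
  unfold levelSq hl
  simp_rw [mul_assoc, integral_const_mul]

lemma levelSq_nonneg (l : ℕ) {f : S2 → ℝ} (hf : Continuous f) : 0 ≤ levelSq l f := by
  rw [levelSq_eq l hf]; exact integral_nonneg fun z => sq_nonneg _

lemma hl_bound (k : ℕ) : ∀ {F : E3 → ℝ}, Sm F → ∃ M, 0 ≤ M ∧ ∀ (l : ℕ) (x : S2),
    lam l ^ k * |hl l (fun y => F y) x| ≤ (2 * l + 1) * M := by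
  induction k with
  | zero =>
    intro F hF
    obtain ⟨C, hC⟩ := (isCompact_univ (X := S2)).exists_bound_of_continuousOn hF.cont.continuousOn
    refine ⟨|C|, abs_nonneg _, fun l x => ?_⟩
    rw [pow_zero, one_mul]
    have hp := Real.pi_pos
    have h1 : ‖hl l (fun y => F y) x‖ ≤ ((2 * l + 1 : ℝ) / (4 * π) * |C|) * sphereArea.real Set.univ := by
      refine norm_integral_le_of_norm_le_const (Filter.Eventually.of_forall fun y => ?_)
      rw [norm_mul]
      exact mul_le_mul (zonal_abs l x y) ((hC y (Set.mem_univ _)).trans (le_abs_self C))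
        (norm_nonneg _) (by positivity)
    rw [area_univ] at h1
    refine h1.trans (le_of_eq ?_)
    field_simp
  | succ k ih =>
    intro F hF
    obtain ⟨M, hM0, hM⟩ := ih hF.lap
    refine ⟨M, hM0, fun l x => ?_⟩
    have := hM l x
    rw [hl_Lap hF, abs_mul, abs_neg, abs_of_nonneg (lam_nonneg l)] at this
    rw [pow_succ, mul_assoc]; exact this

lemma smooth_cont {f : S2 → ℝ} (hf : SmoothOnSphere f) : Continuous f := ContMDiff.continuous hf

lemma hl_bound' (k : ℕ) {f : S2 → ℝ} (hf : SmoothOnSphere f) : ∃ M, 0 ≤ M ∧ ∀ (l : ℕ) (x : S2),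
    lam l ^ k * |hl l f x| ≤ (2 * l + 1) * M := by
  obtain ⟨F, hF, hFf⟩ := smooth_ext hf
  obtain ⟨M, h0, h⟩ := hl_bound k hF
  have e : (fun y : S2 => F y) = f := funext hFf
  rw [e] at h
  exact ⟨M, h0, h⟩

lemma lam_ge (l : ℕ) : ((l:ℝ)+1)^2 ≤ lam (l+1) := by
  unfold lam; push_cast; nlinarith [(by positivity : (0:ℝ) ≤ l)]

lemma lam_one_le (l : ℕ) : 1 ≤ lam (l+1) := by
  have := lam_ge l
  nlinarith [(by positivity : (0:ℝ) ≤ l)]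

lemma summable_sq : Summable (fun l : ℕ => 1 / ((l:ℝ)+1)^2) := by
  have := (summable_nat_add_iff 1).2 (Real.summable_one_div_nat_pow.2 (by norm_num : 1 < 2))
  simpa using this

lemma sob_summable (s : ℝ) {f : S2 → ℝ} (hf : SmoothOnSphere f) :
    Summable (fun l : ℕ => lam (l+1) ^ s * levelSq (l+1) f) := by
  obtain ⟨k, hk⟩ := exists_nat_ge (s + 2)
  obtain ⟨M, hM0, hM⟩ := hl_bound' k hf
  have hc := smooth_cont hf
  refine Summable.of_nonneg_of_le (fun l => mul_nonneg (Real.rpow_nonneg (lam_nonneg _) _)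
    (levelSq_nonneg _ hc)) (fun l => ?_) (summable_sq.mul_left (9 * M^2 * (4 * π)))
  have hl1 := lam_one_le l
  have hl0 : 0 < lam (l+1) := by linarith
  have hp := Real.pi_pos
  -- pointwise bound
  have h1 : ∀ x, hl (l+1) f x ^ 2 ≤ 9 * M^2 * lam (l+1) / (lam (l+1) ^ k) ^ 2 := by
    intro x
    rw [le_div_iff₀ (by positivity)]
    have h := hM (l+1) x
    have h' : lam (l+1) ^ k * |hl (l+1) f x| ≤ 3 * ((l:ℝ)+1) * M := by
      refine h.trans (mul_le_mul_of_nonneg_right ?_ hM0)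
      push_cast; linarith [(by positivity : (0:ℝ) ≤ l)]
    have h2 := pow_le_pow_left₀ (by positivity) h' 2
    rw [mul_pow, sq_abs, mul_pow, mul_pow] at h2
    have h3 := mul_le_mul_of_nonneg_left (lam_ge l) (by positivity : 0 ≤ 9 * M^2)
    linarith
  have h2 : levelSq (l+1) f ≤ (9 * M^2 * lam (l+1) / (lam (l+1) ^ k) ^ 2) * (4 * π) := by
    rw [levelSq_eq _ hc]
    have : ∫ x, hl (l+1) f x ^ 2 ∂sphereArea ≤
        ∫ x : S2, (9 * M^2 * lam (l+1) / (lam (l+1) ^ k) ^ 2) ∂sphereArea :=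
      integral_mono (int_of_cont ((hl_cont _ hc).pow 2)) (integrable_const _) h1
    rw [integral_const, area_univ, smul_eq_mul] at this
    linarith
  have h3 : lam (l+1) ^ s ≤ lam (l+1) ^ k / lam (l+1) ^ 2 := by
    rw [le_div_iff₀ (by positivity), ← Real.rpow_natCast, ← Real.rpow_natCast, ← Real.rpow_add hl0]
    exact Real.rpow_le_rpow_of_exponent_le hl1 (by push_cast; exact hk)
  have h4 : (1:ℝ) ≤ lam (l+1) ^ k := one_le_pow₀ hl1
  calc lam (l+1) ^ s * levelSq (l+1) f
      ≤ (lam (l+1) ^ k / lam (l+1) ^ 2) * ((9 * M^2 * lam (l+1) / (lam (l+1) ^ k) ^ 2) * (4 * π)) :=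
        mul_le_mul h3 h2 (levelSq_nonneg _ hc) (by positivity)
    _ = (9 * M^2 * (4 * π)) * (1 / (lam (l+1) * lam (l+1) ^ k)) := by field_simp
    _ ≤ (9 * M^2 * (4 * π)) * (1 / ((l:ℝ)+1)^2) := by
        refine mul_le_mul_of_nonneg_left ?_ (by positivity)
        refine one_div_le_one_div_of_le (by positivity) ?_
        nlinarith [lam_ge l]

lemma hl_summable {f : S2 → ℝ} (hf : SmoothOnSphere f) (x : S2) :
    Summable (fun l : ℕ => |hl l f x|) := by
  obtain ⟨M, hM0, hM⟩ := hl_bound' 2 hf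
  rw [← summable_nat_add_iff 1]
  refine Summable.of_nonneg_of_le (fun l => abs_nonneg _) (fun l => ?_) (summable_sq.mul_left (3 * M))
  have h := hM (l+1) x
  rw [mul_one_div, le_div_iff₀ (by positivity)]
  have h0 : (0:ℝ) ≤ l := by positivity
  have h1 := lam_ge l
  have h2 : ((l:ℝ)+1)^3 * |hl (l+1) f x| ≤ lam (l+1) ^ 2 * |hl (l+1) f x| := by
    refine mul_le_mul_of_nonneg_right ?_ (abs_nonneg _)
    have h5 : ((l:ℝ)+1)^3 ≤ (((l:ℝ)+1)^2)^2 := by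
      rw [← pow_mul]; exact pow_le_pow_right₀ (by linarith) (by norm_num)
    exact h5.trans (pow_le_pow_left₀ (by positivity) h1 2)
  push_cast at h
  have h3 : ((l:ℝ)+1) * (|hl (l+1) f x| * ((l:ℝ)+1)^2) ≤ ((l:ℝ)+1) * (3 * M) := by nlinarith
  exact le_of_mul_le_mul_left h3 (by linarith)

lemma hl_hasSum {f : S2 → ℝ} (hf : SmoothOnSphere f) (x : S2) :
    HasSum (fun l : ℕ => hl l f x) (f x) := by
  have hs := hl_summable hf x
  have h1 := hl_approx (smooth_cont hf) x
  have h2 : Filter.Tendsto (fun n : ℕ => ∑' l, bet n l * hl l f x) Filter.atTop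
      (nhds (∑' l, hl l f x)) := by
    refine tendsto_tsum_of_dominated_convergence (bound := fun l => |hl l f x|) hs (fun l => ?_) ?_
    · simpa using (bet_tendsto l).mul_const (hl l f x)
    · refine Filter.Eventually.of_forall fun n l => ?_
      rw [norm_mul, Real.norm_eq_abs, Real.norm_eq_abs, abs_of_nonneg (bet_nonneg n l)]
      exact mul_le_of_le_one_left (abs_nonneg _) (bet_le_one n l)
  have h3 : ∀ n, ∑' l, bet n l * hl l f x = ∑ l ∈ range (n+1), bet n l * hl l f x := fun n =>
    tsum_eq_sum fun l hl => by
      rw [bet_eq_zero (by have := mem_range.not.1 hl; omega), zero_mul]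
  simp_rw [h3] at h2
  rw [tendsto_nhds_unique h1 h2]
  exact hs.of_abs.hasSum

lemma zonal_zero (x y : S2) : zonal 0 x y = 1 / (4 * π) := by
  unfold zonal legendreP; simp

lemma hl_zero (f : S2 → ℝ) (x : S2) : hl 0 f x = ∫ y, f y ∂sphereUniform := by
  unfold hl sphereUniform
  have hp := Real.pi_pos
  simp_rw [zonal_zero]
  rw [integral_const_mul, integral_smul_measure, ENNReal.toReal_inv,
    ENNReal.toReal_ofReal (by positivity), one_div, smul_eq_mul]

end WCE
end

end

section
open MeasureTheory Real Metric
open scoped ENNReal RealInnerProductSpace Manifold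

noncomputable section
namespace WCE
open Finset

open scoped ContDiff

section points
variable {N : ℕ} (x : Fin N → S2)

/-- Averaged zonal function of the configuration. -/
def psi (l : ℕ) (y : S2) : ℝ := (1 / N : ℝ) * ∑ i, zonal l (x i) y

/-- Energy of the configuration in degree `l`. -/
def aco (l : ℕ) : ℝ := (1 / N : ℝ) * ∑ i, psi x l (x i)

lemma psi_cont (l : ℕ) : Continuous (psi x l) :=
  continuous_const.mul (continuous_finset_sum _ fun i _ => zonal_cont1 l (x i))

lemma psi_int (l : ℕ) {f : S2 → ℝ} (hf : Continuous f) :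
    ∫ y, psi x l y * f y ∂sphereArea = (1 / N : ℝ) * ∑ i, hl l f (x i) := by
  unfold psi hl
  rw [← integral_finsetSum _ fun i _ => int_of_cont (f := fun y => zonal l (x i) y * f y)
    ((zonal_cont1 l (x i)).mul hf), ← integral_const_mul]
  refine integral_congr_ae (Filter.Eventually.of_forall fun y => ?_)
  show (1 / N : ℝ) * (∑ i, zonal l (x i) y) * f y = (1 / N : ℝ) * ∑ i, zonal l (x i) y * f y
  rw [mul_assoc, sum_mul]

lemma hl_lin {ι : Type*} (S : Finset ι) (c : ι → ℝ) (f : ι → S2 → ℝ) (hf : ∀ i, Continuous (f i))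
    (l : ℕ) (y : S2) :
    hl l (fun z => ∑ i ∈ S, c i * f i z) y = ∑ i ∈ S, c i * hl l (f i) y := by
  unfold hl
  simp_rw [← integral_const_mul]
  rw [← integral_finsetSum _ fun i _ => int_of_cont (f := fun z => c i * (zonal l y z * f i z))
    (continuous_const.mul ((zonal_cont1 l y).mul (hf i)))]
  refine integral_congr_ae (Filter.Eventually.of_forall fun z => ?_)
  show zonal l y z * ∑ i ∈ S, c i * f i z = ∑ i ∈ S, c i * (zonal l y z * f i z)
  rw [mul_sum]; exact sum_congr rfl fun i _ => by ring

lemma psi_eq (l : ℕ) : psi x l = fun z => ∑ i, (1 / N : ℝ) * zonal l (x i) z := by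
  funext z; unfold psi; rw [mul_sum]

lemma hl_psi (l : ℕ) (y : S2) : hl l (psi x l) y = psi x l y := by
  rw [psi_eq, hl_lin _ _ _ fun i => zonal_cont1 l (x i)]
  simp_rw [hl_zonal]

lemma hl_psi_ne {k l : ℕ} (h : k ≠ l) (y : S2) : hl k (psi x l) y = 0 := by
  rw [psi_eq, hl_lin _ _ _ fun i => zonal_cont1 l (x i)]
  simp_rw [hl_zonal_ne h]
  simp

lemma aco_eq (l : ℕ) : aco x l = ∫ y, psi x l y ^ 2 ∂sphereArea := by
  simp_rw [pow_two]
  rw [psi_int x l (psi_cont x l)]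
  simp_rw [hl_psi]; rfl

lemma aco_nonneg (l : ℕ) : 0 ≤ aco x l := by
  rw [aco_eq]; exact integral_nonneg fun z => sq_nonneg _

lemma avg_le {f : Fin N → ℝ} {C : ℝ} (hC : 0 ≤ C) (h : ∀ i, f i ≤ C) : (1 / N : ℝ) * ∑ i, f i ≤ C := by
  have h1 : ∑ i, f i ≤ N * C := by
    have := Finset.sum_le_card_nsmul univ f C (fun i _ => h i)
    simpa using this
  rcases Nat.eq_zero_or_pos N with h0 | h0
  · subst h0; simpa using hC
  · have : (0:ℝ) < N := by exact_mod_cast h0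
    rw [one_div, inv_mul_le_iff₀ this]; exact h1

lemma aco_le (l : ℕ) : aco x l ≤ (2 * l + 1 : ℝ) / (4 * π) := by
  have hp := Real.pi_pos
  have h0 : (0:ℝ) ≤ (2 * l + 1 : ℝ) / (4 * π) := by positivity
  exact avg_le h0 fun i => avg_le h0 fun j => (le_abs_self _).trans (zonal_abs l _ _)

lemma avg_sq (l : ℕ) {f : S2 → ℝ} (hf : Continuous f) :
    ((1 / N : ℝ) * ∑ i, hl l f (x i)) ^ 2 ≤ levelSq l f * aco x l := by
  have h := psi_int x l (hl_cont l hf)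
  simp_rw [hl_idem l hf] at h
  rw [← h, levelSq_eq l hf, aco_eq, mul_comm (∫ x, hl l f x ^ 2 ∂sphereArea)]
  exact cs_int (psi_cont x l) (hl_cont l hf)

lemma err_hasSum (hN : 0 < N) {f : S2 → ℝ} (hf : SmoothOnSphere f) :
    HasSum (fun l : ℕ => (1 / N : ℝ) * ∑ i, hl (l+1) f (x i))
      ((1 / N : ℝ) * ∑ i, f (x i) - ∫ y, f y ∂sphereUniform) := by
  have h1 : HasSum (fun l : ℕ => (1 / N : ℝ) * ∑ i, hl l f (x i)) ((1 / N : ℝ) * ∑ i, f (x i)) :=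
    (hasSum_sum fun i _ => hl_hasSum hf (x i)).mul_left _
  have h2 := (hasSum_nat_add_iff' 1).2 h1
  have hN' : (N:ℝ) ≠ 0 := by exact_mod_cast hN.ne'
  simp only [range_one, sum_singleton, hl_zero, sum_const, card_univ, Fintype.card_fin,
    nsmul_eq_mul] at h2
  rw [one_div, inv_mul_cancel_left₀ hN', ← one_div] at h2
  exact h2

lemma sob_eq (s : ℝ) (f : S2 → ℝ) :
    sobNormSq s f = ∑' l : ℕ, lam (l+1) ^ s * levelSq (l+1) f := by
  unfold sobNormSq lam
  congr 1; funext l; push_cast; ring_nf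

/-- Partial sums of the squared worst-case error. -/
def Dp (s : ℝ) (L : ℕ) : ℝ := ∑ l ∈ range L, lam (l+1) ^ (-s) * aco x (l+1)

lemma Dp_nonneg (s : ℝ) (L : ℕ) : 0 ≤ Dp x s L :=
  sum_nonneg fun _ _ => mul_nonneg (Real.rpow_nonneg (lam_nonneg _) _) (aco_nonneg _ _)

lemma err_le (hN : 0 < N) {s D : ℝ} (hD : ∀ L, Dp x s L ≤ D) {f : S2 → ℝ}
    (hf : SmoothOnSphere f) (h1 : sobNormSq s f ≤ 1) :
    |(∫ y, f y ∂sphereUniform) - (1 / N : ℝ) * ∑ i, f (x i)| ≤ √D := by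
  have hc := smooth_cont hf
  rw [abs_sub_comm]
  have ht := (err_hasSum x hN hf).tendsto_sum_nat.abs
  refine le_of_tendsto ht (Filter.Eventually.of_forall fun L => ?_)
  have hA : ∀ l, 0 ≤ lam (l+1) ^ s * levelSq (l+1) f := fun l =>
    mul_nonneg (Real.rpow_nonneg (lam_nonneg _) _) (levelSq_nonneg _ hc)
  have h2 := sum_sq_le_sum_mul_sum_of_sq_le_mul (range L)
    (r := fun l => (1 / N : ℝ) * ∑ i, hl (l+1) f (x i))
    (f := fun l => lam (l+1) ^ s * levelSq (l+1) f)
    (g := fun l => lam (l+1) ^ (-s) * aco x (l+1))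
    (fun l _ => hA l)
    (fun l _ => mul_nonneg (Real.rpow_nonneg (lam_nonneg _) _) (aco_nonneg _ _))
    (fun l _ => by
      refine (avg_sq x (l+1) hc).trans (le_of_eq ?_)
      have hl0 : 0 < lam (l+1) := lam_pos (by omega)
      have : lam (l+1) ^ s * lam (l+1) ^ (-s) = 1 := by
        rw [← Real.rpow_add hl0]; simp
      linear_combination (-(levelSq (l+1) f * aco x (l+1))) * this)
  have h3 : ∑ l ∈ range L, lam (l+1) ^ s * levelSq (l+1) f ≤ 1 := by
    rw [sob_eq] at h1
    exact ((sob_summable s hf).sum_le_tsum _ fun l _ => hA l).trans h1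
  refine Real.le_sqrt_of_sq_le ?_
  rw [sq_abs]
  refine h2.trans ?_
  have h4 := mul_le_mul_of_nonneg_right h3 (Dp_nonneg x s L)
  rw [one_mul] at h4
  exact h4.trans (hD L)

lemma Dp_bdd {s : ℝ} (hs : 1 < s) : ∃ D, ∀ L, Dp x s L ≤ D := by
  have hp := Real.pi_pos
  have hsum : Summable (fun l : ℕ => 3 / (4 * π) * (((l + 1 : ℕ) : ℝ) ^ (1 - 2 * s))) := by
    refine Summable.mul_left _ ?_
    exact (summable_nat_add_iff (f := fun l : ℕ => (l : ℝ) ^ (1 - 2 * s)) 1).2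
      (Real.summable_nat_rpow.2 (by linarith))
  refine ⟨_, fun L => (sum_le_sum fun l _ => ?_).trans
    (hsum.sum_le_tsum (range L) fun l _ => by positivity)⟩
  have h0 : (0:ℝ) ≤ l := by positivity
  have h1 : (0:ℝ) < (l:ℝ) + 1 := by positivity
  have h2 : lam (l+1) ^ (-s) ≤ ((l:ℝ)+1) ^ (-2 * s) := by
    have := Real.rpow_le_rpow_of_nonpos (by positivity) (lam_ge l) (by linarith : -s ≤ 0)
    refine this.trans (le_of_eq ?_)
    rw [← Real.rpow_natCast, ← Real.rpow_mul h1.le]; congr 1; push_cast; ring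
  have h3 : aco x (l+1) ≤ 3 / (4 * π) * ((l:ℝ)+1) := by
    refine (aco_le x (l+1)).trans ?_
    rw [div_mul_eq_mul_div]
    refine div_le_div_of_nonneg_right ?_ (by positivity)
    push_cast; linarith
  refine (mul_le_mul h2 h3 (aco_nonneg _ _) (by positivity)).trans (le_of_eq ?_)
  push_cast
  rw [show 1 - 2 * s = -2 * s + 1 by ring, Real.rpow_add h1, Real.rpow_one]; ring

/-- The set of errors. -/
def errSet (s : ℝ) : Set ℝ := { r | ∃ f : S2 → ℝ, SmoothOnSphere f ∧ sobNormSq s f ≤ 1 ∧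
    r = |(∫ y, f y ∂sphereUniform) - (1 / N : ℝ) * ∑ i, f (x i)| }

lemma wce_eq (s : ℝ) : wce N s x = sSup (errSet x s) := rfl

lemma wce_nonneg (s : ℝ) : 0 ≤ wce N s x := by
  rw [wce_eq]
  refine Real.sSup_nonneg ?_
  rintro r ⟨f, _, _, rfl⟩
  exact abs_nonneg _

lemma wce_le (hN : 0 < N) {s D : ℝ} (hD : ∀ L, Dp x s L ≤ D) : wce N s x ≤ √D := by
  rw [wce_eq]
  refine Real.sSup_le ?_ (Real.sqrt_nonneg _)
  rintro r ⟨f, hf, h1, rfl⟩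
  exact err_le x hN hD hf h1

lemma psi_smooth (L : ℕ) (c : ℕ → ℝ) :
    SmoothOnSphere (fun z => ∑ l ∈ range L, c l * psi x (l+1) z) := by
  have h : ContDiff ℝ ∞ (fun z : E3 => ∑ l ∈ range L, c l * ((1 / N : ℝ) *
      ∑ i, (zonP (l+1)).eval ⟪z, (x i : E3)⟫)) := by
    refine ContDiff.sum fun l _ => contDiff_const.mul (contDiff_const.mul
      (ContDiff.sum fun i _ => ?_))
    have h1 : ContDiff ℝ ∞ (fun u : ℝ => (zonP (l+1)).eval u) := Polynomial.contDiff_aeval _ ∞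
    have h2 : ContDiff ℝ ∞ (fun z : E3 => ⟪z, (x i : E3)⟫) := contDiff_id.inner ℝ contDiff_const
    exact h1.comp h2
  have h2 := smooth_of_sm h
  have e : (fun z : S2 => ∑ l ∈ range L, c l * psi x (l+1) z) = fun z : S2 =>
      ∑ l ∈ range L, c l * ((1 / N : ℝ) * ∑ i, (zonP (l+1)).eval ⟪(z : E3), (x i : E3)⟫) := by
    funext z; unfold psi; simp_rw [zonal_eq]
  rw [e]; exact h2

lemma le_wce (hN : 0 < N) {s : ℝ} (hs : 1 < s) (L : ℕ) : √(Dp x s L) ≤ wce N s x := by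
  rcases (Dp_nonneg x s L).eq_or_lt with h0 | h0
  · rw [← h0, Real.sqrt_zero]; exact wce_nonneg x s
  obtain ⟨D, hD⟩ := Dp_bdd x hs
  have hbdd : BddAbove (errSet x s) := by
    refine ⟨√D, ?_⟩
    rintro r ⟨f, hf, h1, rfl⟩
    exact err_le x hN hD hf h1
  rw [wce_eq]
  refine le_csSup hbdd ?_
  have hq : 0 < √(Dp x s L) := Real.sqrt_pos.2 h0
  set c : ℕ → ℝ := fun l => (√(Dp x s L))⁻¹ * lam (l+1) ^ (-s) with hc
  set f : S2 → ℝ := fun z => ∑ l ∈ range L, c l * psi x (l+1) z with hf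
  have hfs : SmoothOnSphere f := psi_smooth x L c
  have hfc := smooth_cont hfs
  have hhl : ∀ k y, hl (k+1) f y = if k ∈ range L then c k * psi x (k+1) y else 0 := by
    intro k y
    rw [hf, hl_lin _ _ _ fun l => psi_cont x (l+1)]
    split_ifs with h
    · rw [sum_eq_single k]
      · rw [hl_psi]
      · intro l _ hlk; rw [hl_psi_ne x (by omega), mul_zero]
      · intro h'; exact absurd h h'
    · refine sum_eq_zero fun l hl' => ?_
      have : k ≠ l := fun e => h (e ▸ hl')
      rw [hl_psi_ne x (by omega), mul_zero]
  have hh0 : ∀ y, hl 0 f y = 0 := by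
    intro y
    rw [hf, hl_lin _ _ _ fun l => psi_cont x (l+1)]
    refine sum_eq_zero fun l _ => ?_
    rw [hl_psi_ne x (by omega), mul_zero]
  have hlev : ∀ k, levelSq (k+1) f = if k ∈ range L then c k ^ 2 * aco x (k+1) else 0 := by
    intro k
    rw [levelSq_eq _ hfc, aco_eq]
    simp_rw [hhl]
    split_ifs with h
    · simp_rw [mul_pow]; rw [integral_const_mul]
    · simp
  have hsq : √(Dp x s L) ^ 2 = Dp x s L := Real.sq_sqrt h0.le
  refine ⟨f, hfs, ?_, ?_⟩
  · rw [sob_eq, tsum_eq_sum (s := range L)]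
    · have : ∀ l ∈ range L, lam (l+1) ^ s * levelSq (l+1) f =
          (Dp x s L)⁻¹ * (lam (l+1) ^ (-s) * aco x (l+1)) := by
        intro l hl'
        have hl0 : 0 < lam (l+1) := lam_pos (by omega)
        have e1 : lam (l+1) ^ s * lam (l+1) ^ (-s) = 1 := by
          rw [← Real.rpow_add hl0]; simp
        rw [hlev, if_pos hl', hc]
        simp only [mul_pow, inv_pow, hsq]
        linear_combination ((Dp x s L)⁻¹ * lam (l+1) ^ (-s) * aco x (l+1)) * e1
      rw [sum_congr rfl this, ← mul_sum]
      exact (inv_mul_cancel₀ h0.ne').le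
    · intro l hl'; rw [hlev, if_neg hl', mul_zero]
  · rw [← hl_zero f (x ⟨0, hN⟩), hh0]
    have e : (1 / N : ℝ) * ∑ i, f (x i) = √(Dp x s L) := by
      rw [hf]
      rw [sum_comm, mul_sum]
      have : ∀ l ∈ range L, (1 / N : ℝ) * ∑ i, c l * psi x (l+1) (x i) =
          (√(Dp x s L))⁻¹ * (lam (l+1) ^ (-s) * aco x (l+1)) := by
        intro l _
        unfold aco
        rw [← mul_sum, hc]; ring
      rw [sum_congr rfl this, ← mul_sum]
      show (√(Dp x s L))⁻¹ * Dp x s L = _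
      rw [inv_mul_eq_iff_eq_mul₀ hq.ne', ← pow_two, hsq]
    rw [e, zero_sub, abs_neg, abs_of_pos hq]

end points

lemma wce_zero (s : ℝ) (x : Fin 0 → S2) : wce 0 s x = 0 := by
  rw [wce_eq]
  refine Real.sSup_of_not_bddAbove ?_
  rintro ⟨B, hB⟩
  have hp := Real.pi_pos
  have hS : ∀ c : ℝ, SmoothOnSphere (fun _ => c) := fun c => contMDiff_const
  have hhl : ∀ (c : ℝ) (l : ℕ) (y : S2), hl (l+1) (fun _ => c) y = 0 := by
    intro c l y
    refine hl_eig_ne (F := fun _ => c) (l := 0) (fun x _ => contDiffAt_const) (fun z => ?_) (by omega) y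
    have e : ∀ (d : ℝ) J, Xd J (fun _ => d) = fun _ => 0 := by
      intro d J; funext z; simp [Xd]
    unfold Lap; simp_rw [e]; simp [Xd, lam]
  have h := hB (show |B| + 1 ∈ errSet x s from ⟨fun _ => |B| + 1, hS _, ?_, ?_⟩)
  · linarith [le_abs_self B]
  · rw [sob_eq]
    have : ∀ l : ℕ, lam (l+1) ^ s * levelSq (l+1) (fun _ => |B| + 1) = 0 := by
      intro l
      rw [levelSq_eq _ continuous_const]
      simp_rw [hhl]; simp
    simp_rw [this]; simp
  · have e : ∫ y : S2, (|B| + 1) ∂sphereUniform = |B| + 1 := by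
      have h1 : sphereUniform.real Set.univ = 1 := by
        unfold sphereUniform
        rw [measureReal_ennreal_smul_apply, area_univ, ENNReal.toReal_inv,
          ENNReal.toReal_ofReal (by positivity)]
        exact inv_mul_cancel₀ (by positivity)
      rw [integral_const, h1, one_smul]
    rw [e]; simp
    exact (abs_of_nonneg (by positivity)).symm

end WCE
end

end

section
open MeasureTheory Real Metric
open scoped ENNReal RealInnerProductSpace Manifold

noncomputable section
namespace WCE

lemma exp_bound_num {x : ℝ} (h1 : |x| ≤ 1) :
    Real.exp x ≤ 1 + x + x^2/2 + x^3/6 + x^4/24 + |x|^5 * (6/600) := by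
  have := Real.exp_bound h1 (n := 5) (by norm_num)
  simp [Finset.sum_range_succ, Nat.factorial] at this
  have := (abs_le.1 this).2
  norm_num at this ⊢
  linarith

lemma num_gamma {ε : ℝ} (h0 : 0 < ε) (h1 : ε ≤ 0.15) : Real.Gamma (2+ε) ≤ 1.111 := by
  have h := Real.Gamma_mul_add_mul_le_rpow_Gamma_mul_rpow_Gamma (s := 2) (t := 3)
    (a := 1 - ε) (b := ε) (by norm_num) (by norm_num) (by linarith) h0 (by ring)
  have e3 : Real.Gamma 3 = 2 := by
    rw [show (3:ℝ) = 2 + 1 by norm_num, Real.Gamma_add_one (by norm_num), Real.Gamma_two]; norm_num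
  rw [Real.Gamma_two, e3, Real.one_rpow, one_mul, show (1-ε)*2+ε*3 = 2+ε by ring] at h
  refine h.trans ?_
  rw [Real.rpow_def_of_pos (by norm_num)]
  have hl := Real.log_two_lt_d9
  have : Real.log 2 * ε ≤ 0.104 := by nlinarith [Real.log_two_gt_d9]
  refine (Real.exp_le_exp.2 this).trans ?_
  refine (exp_bound_num (by norm_num [abs_le])).trans ?_
  rw [abs_of_nonneg (by norm_num)]
  norm_num

lemma num_log : Real.log 2.15 ≤ 0.7656 := by
  rw [Real.log_le_iff_le_exp (by norm_num)]
  have := Real.sum_le_exp_of_nonneg (x := 0.7656) (by norm_num) 8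
  refine le_trans ?_ this
  norm_num [Finset.sum_range_succ, Nat.factorial]

lemma num_sse {s : ℝ} (h0 : 2 < s) (h1 : s ≤ 2.15) : s ^ s * Real.exp (-s) ≤ 0.605 := by
  rw [Real.rpow_def_of_pos (by linarith), ← Real.exp_add]
  have hl : Real.log s ≤ 0.7656 + (s / 2.15 - 1) := by
    have h := Real.log_le_sub_one_of_pos (x := s / 2.15) (by positivity)
    rw [Real.log_div (by linarith) (by norm_num)] at h
    linarith [num_log]
  have h2 : Real.log s * s + -s ≤ -0.50396 := by
    have h3 := mul_le_mul_of_nonneg_right hl (by linarith : 0 ≤ s)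
    have h4 : s ^ 2 ≤ 4.15 * s - 4.3 := by nlinarith
    norm_num at h3 h4 h1 ⊢
    nlinarith
  refine (Real.exp_le_exp.2 h2).trans ?_
  refine (exp_bound_num (by norm_num [abs_le])).trans ?_
  rw [abs_of_nonpos (by norm_num)]
  norm_num

lemma numerics {ε : ℝ} (h0 : 0 < ε) (h1 : ε ≤ 0.15) : cComp 2 (2 + ε) ≤ Real.exp (1 / 2) := by
  unfold cComp
  rw [Real.sqrt_le_left (Real.exp_pos _).le, Real.Gamma_two, ← Real.exp_nat_mul]
  have := num_gamma h0 h1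
  have := num_sse (s := 2+ε) (by linarith) (by norm_num at h1 ⊢; linarith)
  have := Real.exp_one_gt_d9
  norm_num at *
  linarith

end WCE
end

end

section
open MeasureTheory Real Metric
open scoped ENNReal RealInnerProductSpace Manifold

noncomputable section
namespace WCE
open Finset

lemma aco_zero {N : ℕ} (x : Fin N → S2) (hN : 0 < N) : 4 * π * aco x 0 = 1 := by
  have hn : (N:ℝ) ≠ 0 := by exact_mod_cast hN.ne'
  have hp := Real.pi_ne_zero
  unfold aco psi
  simp_rw [zonal_zero]
  simp
  field_simp

lemma aco_kernel {N : ℕ} (x : Fin N → S2) (n : ℕ) :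
    ∑ l ∈ range (n+1), bet n l * (4 * π * aco x l) =
      ∑ p : Fin N × Fin N, (1 / N : ℝ) ^ 2 *
        (((n:ℝ)+1) * ((1 + ⟪(x p.1 : E3), (x p.2 : E3)⟫) / 2) ^ n) := by
  have hp := Real.pi_ne_zero
  have h : ∀ p : Fin N × Fin N, (1 / N : ℝ) ^ 2 *
        (((n:ℝ)+1) * ((1 + ⟪(x p.1 : E3), (x p.2 : E3)⟫) / 2) ^ n) =
      ∑ l ∈ range (n+1), (1 / N : ℝ) ^ 2 * (4 * π) * (bet n l * zonal l (x p.2) (x p.1)) := by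
    intro p
    rw [← mul_sum, ← kernel_zonal]
    field_simp
  rw [sum_congr rfl fun p _ => h p, sum_comm]
  refine sum_congr rfl fun l _ => ?_
  unfold aco psi
  rw [Fintype.sum_prod_type]
  simp_rw [← mul_sum]
  ring

lemma main {s' s : ℝ} (h1 : 1 < s') (h2 : s' < s) (N : ℕ) (x : Fin N → S2) :
    wce N s' x ≤ cComp s' s * wce N s x ^ (s' / s) := by
  rcases Nat.eq_zero_or_pos N with h0 | hN
  · subst h0
    rw [wce_zero, wce_zero]
    exact mul_nonneg (Real.sqrt_nonneg _) (Real.rpow_nonneg le_rfl _)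
  have hs : 1 < s := h1.trans h2
  have hs0 : 0 < s := by linarith
  have hG : 0 < Real.Gamma s' := Real.Gamma_pos_of_pos (by linarith)
  have hGs : 0 < Real.Gamma s := Real.Gamma_pos_of_pos hs0
  have hV0 : ∀ L, Dp x s L ≤ wce N s x ^ 2 := fun L => by
    have := le_wce x hN hs L
    rwa [Real.sqrt_le_left (wce_nonneg x s)] at this
  have hw := wce_nonneg x s
  generalize wce N s x = w at hV0 hw ⊢
  rcases hw.eq_or_lt with h0 | hw
  · subst h0
    have ha : ∀ l, aco x (l+1) = 0 := by
      intro l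
      have hle := hV0 (l+1)
      have hs1 : lam (l+1) ^ (-s) * aco x (l+1) ≤ Dp x s (l+1) :=
        single_le_sum (f := fun l => lam (l+1) ^ (-s) * aco x (l+1))
          (fun i _ => mul_nonneg (Real.rpow_nonneg (lam_nonneg _) _) (aco_nonneg _ _))
          (self_mem_range_succ l)
      have hp : 0 < lam (l+1) ^ (-s) := Real.rpow_pos_of_pos (lam_pos (by omega)) _
      have := aco_nonneg x (l+1)
      by_contra hne
      have : 0 < aco x (l+1) := lt_of_le_of_ne this (Ne.symm hne)
      have := mul_pos hp this
      norm_num at hle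
      linarith
    have : wce N s' x ≤ √0 := wce_le x hN (fun L => by unfold Dp; simp [ha])
    rw [Real.sqrt_zero] at this
    exact this.trans (mul_nonneg (Real.sqrt_nonneg _) (Real.rpow_nonneg le_rfl _))
  have hp := Real.pi_gt_three
  set t0 := w ^ (2 / s) with ht0d
  have ht0 : 0 < t0 := Real.rpow_pos_of_pos hw _
  set W := (w ^ (s' / s)) ^ 2 with hW
  have hWp : 0 < W := by have := Real.rpow_pos_of_pos hw (s' / s); positivity
  have hWe : W = t0 ^ s' := by
    rw [hW, ht0d, ← Real.rpow_mul hw.le, ← Real.rpow_natCast, ← Real.rpow_mul hw.le]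
    congr 1; push_cast; ring
  have hwe : w ^ 2 = t0 ^ s := by
    rw [ht0d, ← Real.rpow_mul hw.le, ← Real.rpow_natCast]
    congr 1; push_cast; field_simp
  have e1 : t0 ^ (s' - s) * w ^ 2 = W := by
    rw [hwe, hWe, ← Real.rpow_add ht0]; congr 1; ring
  have e2 : t0 ^ (s' - 1) * t0 = W := by
    rw [hWe]; nth_rewrite 2 [← Real.rpow_one t0]
    rw [← Real.rpow_add ht0]; congr 1; ring
  have e3 : t0 ^ (-s) * w ^ 2 = 1 := by
    rw [hwe, ← Real.rpow_add ht0]; simp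
  set A := s ^ s * Real.exp (-s) with hA
  have hA0 : 0 < A := mul_pos (Real.rpow_pos_of_pos hs0 _) (Real.exp_pos _)
  set K := Real.Gamma s / Real.Gamma s' + (A + 1) / (Real.Gamma s' * (s' - 1)) with hK
  have hd : 0 < s' - 1 := by linarith
  have hK0 : 0 ≤ K := by positivity
  have hbound : ∀ L, Dp x s' L ≤ K * W := by
    intro L
    have hsum : ∀ (r : ℝ) L, ∑ l ∈ range L, lam (l+1) ^ (-r) * (4 * π * aco x (l+1)) =
        4 * π * Dp x r L := by
      intro r L
      unfold Dp; rw [mul_sum]; exact sum_congr rfl fun l _ => by ring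
    have h := compare (fun l => 4 * π * aco x l) (aco_zero x hN)
      (fun l => mul_nonneg (by positivity) (aco_nonneg x l))
      (fun _ : Fin N × Fin N => (1 / N : ℝ) ^ 2)
      (fun p => (1 + ⟪(x p.1 : E3), (x p.2 : E3)⟫) / 2) (aco_kernel x)
      (fun _ => by positivity) (fun p => by linarith [inner_ge (x p.1) (x p.2)])
      (fun p => by linarith [inner_le (x p.1) (x p.2)]) (V := 4 * π * w ^ 2) ht0 h1 h2
      (fun L => by rw [hsum]; exact mul_le_mul_of_nonneg_left (hV0 L) (by positivity)) L
    rw [hsum, ← hA] at h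
    have e : t0 ^ (s' - s) * (Real.Gamma s * (4 * π * w ^ 2)) + t0 ^ (s' - 1) / (s' - 1) *
        (t0 * (1 + A * t0 ^ (-s) * (4 * π * w ^ 2))) =
        4 * π * Real.Gamma s * W + W * (1 + 4 * π * A) / (s' - 1) := by
      have a1 : t0 ^ (s' - s) * (Real.Gamma s * (4 * π * w ^ 2)) =
        4 * π * Real.Gamma s * (t0 ^ (s' - s) * w ^ 2) := by ring
      have a2 : t0 ^ (s' - 1) / (s' - 1) * (t0 * (1 + A * t0 ^ (-s) * (4 * π * w ^ 2))) =
        (t0 ^ (s' - 1) * t0) * (1 + 4 * π * A * (t0 ^ (-s) * w ^ 2)) / (s' - 1) := by ring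
      rw [a1, a2, e1, e2, e3, mul_one]
    rw [e] at h
    have h3 : W * (1 + 4 * π * A) / (s' - 1) ≤ W * (4 * π * (A + 1)) / (s' - 1) := by
      gcongr; linarith
    have h4 : Real.Gamma s' * (4 * π) * (K * W) =
        4 * π * Real.Gamma s * W + W * (4 * π * (A + 1)) / (s' - 1) := by
      rw [hK]; field_simp
    have h5 : 0 < Real.Gamma s' * (4 * π) := by positivity
    refine le_of_mul_le_mul_left ?_ h5
    rw [h4]; linarith
  have := wce_le x hN hbound
  rwa [Real.sqrt_mul hK0, hW, Real.sqrt_sq (Real.rpow_nonneg hw.le _)] at this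

end WCE
end

end

/-- If `1 < s' < s` and `wce(x_N; s) ≤ 1`, then
`wce(x_N; s') ≤ c(s', s) wce(x_N; s)^{s'/s}`; moreover `c(2, 2+ε) ≤ e^{1/2}` for
`0 < ε ≤ 0.15`. -/
theorem wce_comparison_different_smoothness :
    (∀ s' s : ℝ, 1 < s' → s' < s → ∀ N : ℕ, ∀ x : Fin N → S2,
      wce N s x ≤ 1 → wce N s' x ≤ cComp s' s * wce N s x ^ (s' / s)) ∧
    (∀ ε : ℝ, 0 < ε → ε ≤ 0.15 → cComp 2 (2 + ε) ≤ Real.exp (1 / 2)) := by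
  exact ⟨fun _ _ h1 h2 N x _ => WCE.main h1 h2 N x, fun _ h0 h1 => WCE.numerics h0 h1⟩

end
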